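/- Let A be any C*-algebra with stable rank one. Then the stable rank of C([0,1],A) equals 1 if A has no K₁-obstructions, and equals 2 otherwise. -/

import Mathlib

noncomputable section

set_option maxHeartbeats 1000000

def StableRankOne (A : Type*) [NonUnitalCStarAlgebra A] : Prop :=
  Dense {x : Unitization ℂ A | IsUnit x}

def K1Trivial (B : Type*) [NonUnitalCStarAlgebra B] : Prop :=
  ∀ n : ℕ, 0 < n → ∀ u : unitary (Matrix (Fin n) (Fin n) (Unitization ℂ B)),
    ∃ (k : ℕ) (h : Matrix.fromBlocks u.1 0 0
        (1 : Matrix (Fin k) (Fin k) (Unitization ℂ B)) ∈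
        unitary (Matrix (Fin n ⊕ Fin k) (Fin n ⊕ Fin k) (Unitization ℂ B))),
      Joined (1 : unitary (Matrix (Fin n ⊕ Fin k) (Fin n ⊕ Fin k) (Unitization ℂ B)))
        ⟨Matrix.fromBlocks u.1 0 0 1, h⟩

def NoK1Obstructions (A : Type*) [NonUnitalCStarAlgebra A] : Prop :=
  StableRankOne A ∧
    ∀ (B : NonUnitalStarSubalgebra ℂ A) [IsClosed (B : Set A)],
      (∀ b ∈ B, ∀ a : A, ∀ b' ∈ B, b * a * b' ∈ B) → K1Trivial B

/-- `sr(A) ≤ n`: the left-invertible `n`-tuples over the minimal unitization are dense. -/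
def StableRankLE (A : Type*) [NonUnitalCStarAlgebra A] (n : ℕ) : Prop :=
  Dense {a : Fin n → Unitization ℂ A | ∃ b : Fin n → Unitization ℂ A, ∑ i, b i * a i = 1}

/-- The stable rank of a C*-algebra: the least `n ≥ 1` with `sr(A) ≤ n`. -/
def stableRank (A : Type*) [NonUnitalCStarAlgebra A] : ℕ :=
  sInf {n : ℕ | 0 < n ∧ StableRankLE A n}

section

open scoped Topology

theorem isUnit_of_norm_mul_norm_sub_lt {R : Type*} [NormedRing R] [HasSummableGeomSeries R]
    {x y k : R} (h₁ : k * x = 1) (h₂ : x * k = 1) (h : ‖k‖ * ‖y - x‖ < 1) : IsUnit y := by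
  have h1 : ‖-(k * (y - x))‖ < 1 := by
    rw [norm_neg]; exact (norm_mul_le _ _).trans_lt h
  have h2 := isUnit_one_sub_of_norm_lt_one h1
  have hx : IsUnit x := ⟨⟨x, k, h₂, h₁⟩, rfl⟩
  have : y = x * (1 - -(k * (y - x))) := by
    rw [sub_neg_eq_add, mul_add, ← mul_assoc, h₂]; simp
  rw [this]
  exact hx.mul h2

theorem isUnit_of_norm_sub_unitary_lt_one {R : Type*} [CStarAlgebra R] {x w : R}
    (hw : w ∈ unitary R) (h : ‖x - w‖ < 1) : IsUnit x := by
  nontriviality R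
  refine isUnit_of_norm_mul_norm_sub_lt (x := w) (k := star w)
    (Unitary.star_mul_self_of_mem hw) (Unitary.mul_star_self_of_mem hw) ?_
  rw [norm_star, CStarRing.norm_of_mem_unitary hw, one_mul]
  exact h

section Polar

variable {R : Type*} [CStarAlgebra R] [PartialOrder R] [StarOrderedRing R]

theorem isUnit_of_norm_sub_lt_of_le {h y : R} {c : ℝ} (hc : 0 < c) (hh : algebraMap ℝ R c ≤ h)
    (hy : ‖y - h‖ < c) : IsUnit y := by
  have hsp : ∀ x ∈ spectrum ℝ h, c ≤ x := by
    have hsa : IsSelfAdjoint h := by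
      have h0 : (0 : R) ≤ algebraMap ℝ R c := algebraMap_nonneg R hc.le
      exact (h0.trans hh).isSelfAdjoint
    exact (algebraMap_le_iff_le_spectrum).1 hh
  have hsa : IsSelfAdjoint h := by
    have h0 : (0 : R) ≤ algebraMap ℝ R c := algebraMap_nonneg R hc.le
    exact (h0.trans hh).isSelfAdjoint
  have hne : ∀ x ∈ spectrum ℝ h, x ≠ 0 := fun x hx => (hc.trans_le (hsp x hx)).ne'
  have hcont : ContinuousOn (fun x : ℝ => x⁻¹) (spectrum ℝ h) :=
    continuousOn_inv₀.mono fun x hx => hne x hx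
  have hmul : cfc (fun x : ℝ => x⁻¹) h * h = 1 := by
    conv_lhs => rw [← cfc_id' ℝ h (ha := hsa), cfc_id' ℝ h (ha := hsa)]
    nth_rewrite 2 [← cfc_id' ℝ h]
    rw [← cfc_mul (fun x : ℝ => x⁻¹) (fun x => x) h, ← cfc_one ℝ h]
    exact cfc_congr fun x hx => inv_mul_cancel₀ (hne x hx)
  have hmul' : h * cfc (fun x : ℝ => x⁻¹) h = 1 := by
    nth_rewrite 1 [← cfc_id' ℝ h]
    rw [← cfc_mul (fun x => x) (fun x : ℝ => x⁻¹) h, ← cfc_one ℝ h]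
    exact cfc_congr fun x hx => mul_inv_cancel₀ (hne x hx)
  refine isUnit_of_norm_mul_norm_sub_lt hmul hmul' ?_
  have hn : ‖cfc (fun x : ℝ => x⁻¹) h‖ ≤ c⁻¹ := by
    refine norm_cfc_le (by positivity) fun x hx => ?_
    have := hsp x hx
    rw [norm_inv, Real.norm_of_nonneg (hc.le.trans this)]
    exact inv_anti₀ hc this
  calc _ ≤ c⁻¹ * ‖y - h‖ := by gcongr
    _ < c⁻¹ * c := by gcongr
    _ = 1 := inv_mul_cancel₀ hc.ne'

theorem isUnit_cfcAbs {a : R} (ha : IsUnit a) : IsUnit (CFC.abs a) := by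
  have h : IsUnit (CFC.abs a * CFC.abs a) := by
    rw [CFC.abs_mul_abs]; exact ha.star.mul ha
  exact ((Commute.refl _).isUnit_mul_iff.1 h).1

/-- The unitary part of the polar decomposition of an invertible element. -/
def polarUnitary (a : R) : R := a * Ring.inverse (CFC.abs a)

theorem polarUnitary_mul_abs {a : R} (ha : IsUnit a) : polarUnitary a * CFC.abs a = a := by
  rw [polarUnitary, mul_assoc, Ring.inverse_mul_cancel _ (isUnit_cfcAbs ha), mul_one]

theorem polarUnitary_mem_unitary {a : R} (ha : IsUnit a) : polarUnitary a ∈ unitary R := by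
  have hu := isUnit_cfcAbs ha
  have hs : star (Ring.inverse (CFC.abs a)) = Ring.inverse (CFC.abs a) := by
    rw [← Ring.inverse_star, (CFC.abs_nonneg a).isSelfAdjoint.star_eq]
  have h1 : star (polarUnitary a) * polarUnitary a = 1 := by
    rw [polarUnitary, star_mul, hs, mul_assoc, ← mul_assoc (star a), ← CFC.abs_mul_abs,
      mul_assoc (CFC.abs a), Ring.mul_inverse_cancel _ hu, mul_one, Ring.inverse_mul_cancel _ hu]
  have hpu : IsUnit (polarUnitary a) := ha.mul hu.ringInverse
  refine Unitary.mem_iff.2 ⟨h1, ?_⟩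
  apply hpu.mul_right_cancel
  rw [mul_assoc, h1, mul_one, one_mul]

theorem polarUnitary_of_mem_unitary {u : R} (hu : u ∈ unitary R) : polarUnitary u = u := by
  rw [polarUnitary, CFC.abs_of_mem_unitary hu, Ring.inverse_one, mul_one]

theorem continuousOn_polarUnitary : ContinuousOn (polarUnitary : R → R) {a | IsUnit a} := by
  intro a ha
  refine ContinuousAt.continuousWithinAt ?_
  refine continuousAt_id.mul ?_
  obtain ⟨v, hv⟩ := isUnit_cfcAbs (show IsUnit a from ha)
  refine ContinuousAt.comp (g := Ring.inverse) (f := CFC.abs) ?_ CFC.continuous_abs.continuousAt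
  rw [← hv]
  exact NormedRing.inverse_continuousAt v

end Polar

theorem Unitary.joined_of_joinedIn_isUnit {R : Type*} [CStarAlgebra R] (u v : unitary R)
    (h : JoinedIn {x : R | IsUnit x} u v) : Joined u v := by
  let : PartialOrder R := CStarAlgebra.spectralOrder R
  have : StarOrderedRing R := CStarAlgebra.spectralOrderedRing R
  obtain ⟨γ, hγ⟩ := h
  refine ⟨⟨⟨fun t => ⟨polarUnitary (γ t), polarUnitary_mem_unitary (hγ t)⟩, ?_⟩, ?_, ?_⟩⟩
  · exact Continuous.subtype_mk
      (continuousOn_polarUnitary.comp_continuous γ.continuous fun t => hγ t) _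
  · ext; simp [polarUnitary_of_mem_unitary u.2]
  · ext; simp [polarUnitary_of_mem_unitary v.2]

theorem stableRankLE_one_iff {A : Type*} [NonUnitalCStarAlgebra A] :
    StableRankLE A 1 ↔ StableRankOne A := by
  have hhomeo : StableRankLE A 1 ↔ Dense {x : Unitization ℂ A | ∃ y, y * x = 1} := by
    let e := Homeomorph.funUnique (Fin 1) (Unitization ℂ A)
    constructor
    · intro h x
      have h1 := map_mem_closure e.continuous (h (e.symm x))
        (t := {x | ∃ y, y * x = 1}) fun a ⟨b, hb⟩ => ⟨b 0, by simpa [e] using hb⟩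
      simpa using h1
    · intro h x
      have h1 := map_mem_closure e.symm.continuous (h (e x))
        (t := {a : Fin 1 → Unitization ℂ A | ∃ b : Fin 1 → Unitization ℂ A, ∑ i, b i * a i = 1})
        fun a ⟨b, hb⟩ => ⟨fun _ => b, by simpa [e] using hb⟩
      simpa using h1
  rw [hhomeo, StableRankOne]
  refine ⟨fun h => ?_, fun h => h.mono ?_⟩
  · convert h using 1
    ext x
    simp only [Set.mem_ofPred_eq]
    refine ⟨fun hx => hx.exists_left_inv, ?_⟩
    rintro ⟨b, hb⟩
    have hopen : IsOpen {c : Unitization ℂ A | IsUnit (c * x)} :=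
      Units.isOpen.preimage (f := fun c => c * x) (by fun_prop)
    obtain ⟨c, ⟨d, hd⟩, hc⟩ := h.exists_mem_open hopen ⟨b, by simp [hb]⟩
    obtain ⟨v, hv⟩ := (show IsUnit (c * x) from hc)
    have hcu : IsUnit c := by
      refine isUnit_iff_exists.2 ⟨d, ?_, hd⟩
      have h1 : c * (x * ↑v⁻¹) = 1 := by rw [← mul_assoc, ← hv, Units.mul_inv]
      have h2 : d = x * ↑v⁻¹ := left_inv_eq_right_inv hd h1
      rw [h2, h1]
    have : IsUnit (c * x) := hc
    exact (Units.isUnit_units_mul hcu.unit x).1 this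
  · intro x hx
    exact (show IsUnit x from hx).exists_left_inv

theorem Unitization.continuous_fst' {A : Type*} [NonUnitalCStarAlgebra A] :
    Continuous (fun x : Unitization ℂ A => x.fst) :=
  continuous_fst.comp Unitization.uniformEquivProd.continuous

theorem Unitization.continuous_snd' {A : Type*} [NonUnitalCStarAlgebra A] :
    Continuous (fun x : Unitization ℂ A => x.snd) :=
  continuous_snd.comp Unitization.uniformEquivProd.continuous

theorem Unitization.continuous_inr' {A : Type*} [NonUnitalCStarAlgebra A] :
    Continuous (Unitization.inr : A → Unitization ℂ A) :=
  (Unitization.isometry_inr (𝕜 := ℂ) (A := A)).continuous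

theorem Unitization.eq_smul_one_add {A : Type*} [NonUnitalCStarAlgebra A] (x : Unitization ℂ A)
    (hx : x.fst ≠ 0) : x = x.fst • (1 + Unitization.inr (x.fst⁻¹ • x.snd)) := by
  ext <;> simp [hx]

theorem Unitization.isUnit_iff_isQuasiregular {A : Type*} [NonUnitalCStarAlgebra A]
    (x : Unitization ℂ A) (hx : x.fst ≠ 0) : IsUnit x ↔ IsQuasiregular (x.fst⁻¹ • x.snd) := by
  rw [isQuasiregular_iff_isUnit' ℂ]
  conv_lhs => rw [Unitization.eq_smul_one_add x hx]
  exact isUnit_smul_iff (Units.mk0 _ hx) _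

theorem stableRankOne_iff_dense_isQuasiregular {A : Type*} [NonUnitalCStarAlgebra A] :
    StableRankOne A ↔ Dense {a : A | IsQuasiregular a} := by
  constructor
  · intro h a
    rw [mem_closure_iff_nhds]
    intro t ht
    let x : Unitization ℂ A := 1 + Unitization.inr a
    have hx : ContinuousAt (fun y : Unitization ℂ A => y.fst⁻¹ • y.snd) x :=
      (Unitization.continuous_fst'.continuousAt.inv₀ (by simp [x])).smul
        Unitization.continuous_snd'.continuousAt
    have h1 : ∀ᶠ y in 𝓝 x, y.fst⁻¹ • y.snd ∈ t := hx (by simpa [x] using ht)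
    have h2 : ∀ᶠ y in 𝓝 x, y.fst ≠ 0 :=
      Unitization.continuous_fst'.continuousAt.eventually_ne (by simp [x])
    obtain ⟨y, ⟨hy1, hy2⟩, hy3⟩ := mem_closure_iff_nhds.1 (h x) _ (h1.and h2)
    exact ⟨_, hy1, (y.isUnit_iff_isQuasiregular hy2).1 hy3⟩
  · intro h
    have key : ∀ x : Unitization ℂ A, x.fst ≠ 0 → x ∈ closure {x : Unitization ℂ A | IsUnit x} := by
      intro x hx
      have hc : Continuous (fun b : A => x.fst • (1 + Unitization.inr b : Unitization ℂ A)) :=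
        (continuous_const_smul x.fst).comp (continuous_const.add Unitization.continuous_inr')
      rw [Unitization.eq_smul_one_add x hx]
      refine map_mem_closure (f := fun b : A => x.fst • (1 + Unitization.inr b : Unitization ℂ A))
        hc (h (x.fst⁻¹ • x.snd)) fun b hb => ?_
      exact (isUnit_smul_iff (Units.mk0 _ hx) _).2 ((isQuasiregular_iff_isUnit' ℂ).1 hb)
    intro x
    have hd : Dense ({0}ᶜ : Set ℂ) := dense_compl_singleton 0
    let f : ℂ → Unitization ℂ A := fun s => s • 1 + Unitization.inr x.snd
    have hc : Continuous f := by fun_prop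
    have hx : f x.fst = x := by ext <;> simp [f]
    rw [← closure_closure, ← hx]
    refine map_mem_closure hc (hd x.fst) fun s hs => key _ ?_
    have : s ≠ 0 := hs
    simpa [f] using this

/-- Hereditary star subalgebras: those `S` with `S A S ⊆ S`. -/
def IsHereditary {A : Type*} [NonUnitalCStarAlgebra A] (S : NonUnitalStarSubalgebra ℂ A) : Prop :=
  ∀ b ∈ S, ∀ a : A, ∀ b' ∈ S, b * a * b' ∈ S

theorem IsHereditary.exists_isQuasiregular_near {A : Type*} [NonUnitalCStarAlgebra A]
    (hA : Dense {a : A | IsQuasiregular a}) {S : NonUnitalStarSubalgebra ℂ A}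
    (hS : IsHereditary S) {d : A} (hd : d ∈ S) {ε : ℝ} (hε : 0 < ε) :
    ∃ d' ∈ S, ‖d' - d‖ < ε ∧ IsQuasiregular d' := by
  let : PartialOrder (Unitization ℂ A) := CStarAlgebra.spectralOrder (Unitization ℂ A)
  have : StarOrderedRing (Unitization ℂ A) := CStarAlgebra.spectralOrderedRing (Unitization ℂ A)
  let F : A → Unitization ℂ A := fun b => 1 + Unitization.inr b
  have hF : Continuous F := continuous_const.add Unitization.continuous_inr'
  let P : A → Unitization ℂ A := fun b => 1 - F b * star (F b)
  let Q : A → Unitization ℂ A := fun b => 1 - star (F b) * F b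
  have hP : Continuous P := by fun_prop
  have hQ : Continuous Q := by fun_prop
  set K := ‖P d‖ * ‖Q d‖ + 1 with hK
  have hKpos : 0 < K := by positivity
  set δ := ε / (2 * K) with hδ
  have hδpos : 0 < δ := by positivity
  set c := min (1 / 2) (δ / 2) with hc
  have hcpos : 0 < c := by positivity
  have hev : ∀ᶠ b in 𝓝 d,
      ‖F d - F b‖ + δ * (‖P d - P b‖ * ‖Q d‖ + ‖P b‖ * ‖Q d - Q b‖) < c := by
    have hcont : Continuous fun b =>
      ‖F d - F b‖ + δ * (‖P d - P b‖ * ‖Q d‖ + ‖P b‖ * ‖Q d - Q b‖) := by fun_prop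
    exact hcont.continuousAt.eventually_lt continuousAt_const (by simpa using hcpos)
  obtain ⟨b, hb1, hb2⟩ := mem_closure_iff_nhds.1 (hA d) _ hev
  have hb1 : ‖F d - F b‖ + δ * (‖P d - P b‖ * ‖Q d‖ + ‖P b‖ * ‖Q d - Q b‖) < c := hb1
  set r : Unitization ℂ A := F b with hr
  have hru : IsUnit r := (isQuasiregular_iff_isUnit' ℂ).1 hb2
  set u := polarUnitary r with hu
  have huu : u ∈ unitary (Unitization ℂ A) := polarUnitary_mem_unitary hru
  have hunorm : ‖u‖ ≤ 1 := CStarRing.norm_of_mem_unitary huu |>.le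
  have hur : u * CFC.abs r = r := polarUnitary_mul_abs hru
  have hcomm : u * Q b = P b * u := by
    have h1 : u * (star r * r) = r * CFC.abs r := by
      rw [← CFC.abs_mul_abs, ← mul_assoc, hur]
    have h2 : r * star r * u = r * CFC.abs r := by
      have : star r = CFC.abs r * star u := by
        conv_lhs => rw [← hur]
        rw [star_mul, (CFC.abs_nonneg r).isSelfAdjoint.star_eq]
      rw [mul_assoc, this, mul_assoc, Unitary.star_mul_self_of_mem huu, mul_one]
    simp only [P, Q, mul_sub, sub_mul, ← hr, h1, h2, mul_one, one_mul]
  set h : Unitization ℂ A := CFC.abs r + δ • (Q b * Q b) with hh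
  have hhle : algebraMap ℝ (Unitization ℂ A) c ≤ h := by
    have hcfc : h = cfc (fun t : ℝ => t + δ • ((1 - t ^ 2) * (1 - t ^ 2))) (CFC.abs r) := by
      have hk : IsSelfAdjoint (CFC.abs r) := (CFC.abs_nonneg r).isSelfAdjoint
      have hQk : Q b = cfc (fun t : ℝ => 1 - t ^ 2) (CFC.abs r) := by
        rw [cfc_sub .., cfc_pow .., cfc_id' ℝ (CFC.abs r), cfc_const_one .., CFC.abs_sq]
      rw [cfc_add .., cfc_smul .., cfc_mul .., ← hQk, cfc_id' ℝ (CFC.abs r)]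
    rw [hcfc]
    refine algebraMap_le_cfc _ _ _ fun t ht => ?_
    have ht0 : 0 ≤ t := spectrum_nonneg_of_nonneg (CFC.abs_nonneg r) ht
    rcases le_total (1 / 2) t with h2 | h2
    · calc c ≤ 1 / 2 := min_le_left _ _
        _ ≤ t := h2
        _ ≤ _ := le_add_of_nonneg_right (smul_nonneg hδpos.le (mul_self_nonneg _))
    · have : δ / 2 ≤ δ * ((1 - t ^ 2) * (1 - t ^ 2)) := by
        rw [div_eq_mul_one_div]
        gcongr
        nlinarith
      calc c ≤ δ / 2 := min_le_right _ _
        _ ≤ δ * ((1 - t ^ 2) * (1 - t ^ 2)) := this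
        _ ≤ _ := le_add_of_nonneg_left ht0
  set a' : Unitization ℂ A := F d + δ • (P d * u * Q d) with ha'
  have huh : u * h = r + δ • (P b * u * Q b) := by
    rw [hh, mul_add, hur, mul_smul_comm, ← mul_assoc, hcomm]
  have hnear : ‖star u * a' - h‖ < c := by
    have h1 : star u * a' - h = star u * (a' - u * h) := by
      rw [mul_sub, ← mul_assoc (star u) u, Unitary.star_mul_self_of_mem huu, one_mul]
    have h2 : a' - u * h =
        (F d - r) + δ • ((P d - P b) * u * Q d + P b * u * (Q d - Q b)) := by
      rw [huh, ha']
      simp only [smul_add, smul_sub, mul_sub, sub_mul]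
      abel
    have hsu : ‖star u‖ ≤ 1 := by rwa [norm_star]
    calc ‖star u * a' - h‖ ≤ ‖star u‖ * ‖a' - u * h‖ := by rw [h1]; exact norm_mul_le _ _
      _ ≤ 1 * ‖a' - u * h‖ := by gcongr
      _ = ‖a' - u * h‖ := one_mul _
      _ ≤ ‖F d - r‖ + δ * (‖P d - P b‖ * 1 * ‖Q d‖ + ‖P b‖ * 1 * ‖Q d - Q b‖) := by
        rw [h2]
        refine (norm_add_le _ _).trans ?_
        rw [norm_smul, Real.norm_of_nonneg hδpos.le]
        gcongr
        refine (norm_add_le _ _).trans ?_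
        gcongr
        · refine (norm_mul_le _ _).trans ?_
          gcongr
          refine (norm_mul_le _ _).trans ?_
          gcongr
        · refine (norm_mul_le _ _).trans ?_
          gcongr
          refine (norm_mul_le _ _).trans ?_
          gcongr
      _ < c := by simpa only [mul_one] using hb1
  have hunit : IsUnit a' := by
    have h1 : IsUnit (star u * a') := isUnit_of_norm_sub_lt_of_le hcpos hhle hnear
    have h2 : IsUnit u := (Unitary.toUnits ⟨u, huu⟩).isUnit
    have h3 := h2.mul h1
    rwa [← mul_assoc, Unitary.mul_star_self_of_mem huu, one_mul] at h3
  have hPmem : ∃ p ∈ S, P d = Unitization.inr p := by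
    refine ⟨-(d + star d + d * star d), ?_, ?_⟩
    · exact neg_mem (add_mem (add_mem hd (star_mem hd)) (mul_mem hd (star_mem hd)))
    · simp only [P, F, star_add, star_one, Unitization.inr_star, Unitization.inr_neg,
        Unitization.inr_add, Unitization.inr_mul]
      noncomm_ring
  have hQmem : ∃ q ∈ S, Q d = Unitization.inr q := by
    refine ⟨-(d + star d + star d * d), ?_, ?_⟩
    · exact neg_mem (add_mem (add_mem hd (star_mem hd)) (mul_mem (star_mem hd) hd))
    · simp only [Q, F, star_add, star_one, Unitization.inr_star, Unitization.inr_neg,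
        Unitization.inr_add, Unitization.inr_mul]
      noncomm_ring
  obtain ⟨p, hpS, hp⟩ := hPmem
  obtain ⟨q, hqS, hq⟩ := hQmem
  have hmem : ∃ z ∈ S, P d * u * Q d = Unitization.inr z := by
    refine ⟨u.fst • (p * q) + p * u.snd * q,
      add_mem (SMulMemClass.smul_mem _ (mul_mem hpS hqS)) (hS p hpS _ q hqS), ?_⟩
    have : u = u.fst • 1 + Unitization.inr u.snd := by ext <;> simp
    rw [hp, hq]
    conv_lhs => rw [this]
    simp [mul_add, add_mul]
  obtain ⟨z, hzS, hz⟩ := hmem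
  have hznorm : ‖z‖ ≤ ‖P d‖ * ‖Q d‖ := by
    rw [← Unitization.norm_inr (𝕜 := ℂ) z, ← hz]
    calc _ ≤ ‖P d‖ * ‖u‖ * ‖Q d‖ := by
          refine (norm_mul_le _ _).trans ?_
          gcongr
          exact norm_mul_le _ _
      _ ≤ ‖P d‖ * 1 * ‖Q d‖ := by gcongr
      _ = _ := by rw [mul_one]
  refine ⟨d + (δ : ℂ) • z, add_mem hd (SMulMemClass.smul_mem _ hzS), ?_, ?_⟩
  · rw [add_sub_cancel_left, norm_smul, Complex.norm_real, Real.norm_of_nonneg hδpos.le]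
    calc δ * ‖z‖ ≤ δ * K := by gcongr; linarith
      _ = ε / 2 := by rw [hδ]; field_simp
      _ < ε := half_lt_self hε
  · rw [isQuasiregular_iff_isUnit' ℂ]
    convert hunit using 1
    rw [ha', hz, Unitization.inr_add, Unitization.inr_smul, ← add_assoc]
    congr 1

theorem IsHereditary.isQuasiregular_iff {A : Type*} [NonUnitalCStarAlgebra A]
    {S : NonUnitalStarSubalgebra ℂ A} (hS : IsHereditary S) (b : S) :
    IsQuasiregular b ↔ IsQuasiregular (b : A) := by
  simp only [_root_.isQuasiregular_iff]
  constructor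
  · rintro ⟨y, h1, h2⟩
    exact ⟨y, congrArg Subtype.val h1, congrArg Subtype.val h2⟩
  · rintro ⟨y, h1, h2⟩
    have hy : y = -(b : A) + b * b + b * y * b := by
      have h3 : y = -(b : A) - b * y := by
        rw [eq_sub_iff_add_eq, eq_neg_iff_add_eq_zero, ← h1]; abel
      have h4 : y = -(b : A) - y * b := by
        rw [eq_sub_iff_add_eq, eq_neg_iff_add_eq_zero, ← h2]; abel
      conv_lhs => rw [h3, h4]
      noncomm_ring
    have hmem : y ∈ S := by
      rw [hy]
      exact add_mem (add_mem (neg_mem b.2) (mul_mem b.2 b.2)) (hS _ b.2 _ _ b.2)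
    exact ⟨⟨y, hmem⟩, Subtype.ext h1, Subtype.ext h2⟩

theorem IsHereditary.dense_isQuasiregular {A : Type*} [NonUnitalCStarAlgebra A]
    (hA : Dense {a : A | IsQuasiregular a}) {S : NonUnitalStarSubalgebra ℂ A}
    (hS : IsHereditary S) : Dense {b : S | IsQuasiregular b} := by
  intro b
  rw [Metric.mem_closure_iff]
  intro ε hε
  obtain ⟨d, hd, hd1, hd2⟩ := hS.exists_isQuasiregular_near hA b.2 hε
  refine ⟨⟨d, hd⟩, (hS.isQuasiregular_iff _).2 hd2, ?_⟩
  rw [dist_comm, Subtype.dist_eq, dist_eq_norm]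
  exact hd1

open Metric in
/-- A function on the interval with values in the closure of `T` can be approximated by a function
with values in `S` if nearby points of `T` can be joined locally by paths in `S`. -/
theorem exists_continuousMap_near_of_joinedIn {E : Type*} [PseudoMetricSpace E]
    (F : C(unitInterval, E)) {S T : Set E} (hT : ∀ t, F t ∈ closure T)
    (hloc : ∀ t, ∀ η > 0, ∃ δ > 0, ∀ a ∈ T, ∀ b ∈ T, dist a (F t) < δ → dist b (F t) < δ →
      JoinedIn (S ∩ ball (F t) η) a b) {ε : ℝ} (hε : 0 < ε) :
    ∃ G : C(unitInterval, E), ∀ t, G t ∈ S ∧ dist (G t) (F t) < ε := by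
  choose δ hδ hδJ using fun t => hloc t (ε / 2) (half_pos hε)
  let V : unitInterval → Set unitInterval := fun s => {t | dist (F t) (F s) < min (δ s / 2) (ε / 2)}
  have hVo : ∀ s, IsOpen (V s) := fun s => isOpen_lt (by fun_prop) continuous_const
  have hVc : Set.univ ⊆ ⋃ s, V s := fun t _ => Set.mem_iUnion.2
    ⟨t, show dist (F t) (F t) < _ by rw [dist_self]; exact lt_min (half_pos (hδ t)) (half_pos hε)⟩
  obtain ⟨t, ht0, htm, ⟨N, hN⟩, hsub⟩ := exists_monotone_Icc_subset_open_cover_unitInterval hVo hVc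
  have hstep : ∀ n, ∀ ρ > 0, ∃ G : C(unitInterval, E),
      (∀ s ≤ t n, G s ∈ S ∧ dist (G s) (F s) < ε) ∧ G (t n) ∈ T ∧ dist (G (t n)) (F (t n)) < ρ := by
    intro n
    induction n with
    | zero =>
      intro ρ hρ
      obtain ⟨a, haT, ha⟩ := Metric.mem_closure_iff.1 (hT 0) (min ρ (min (δ 0) ε))
        (lt_min hρ (lt_min (hδ 0) hε))
      rw [dist_comm, lt_min_iff, lt_min_iff] at ha
      refine ⟨.const _ a, fun s hs => ?_, haT, ?_⟩
      · have : s = 0 := le_antisymm (hs.trans ht0.le) s.2.1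
        subst this
        exact ⟨((hδJ 0 a haT a haT ha.2.1 ha.2.1).source_mem).1, ha.2.2⟩
      · rw [ht0]
        exact ha.1
    | succ n ih =>
      intro ρ hρ
      rcases (htm n.le_succ).eq_or_lt with heq | hlt
      · rw [← Nat.succ_eq_add_one, ← heq]
        exact ih ρ hρ
      obtain ⟨i, hi⟩ := hsub n
      obtain ⟨a, haT, ha⟩ := Metric.mem_closure_iff.1 (hT (t (n + 1))) (min ρ (δ i / 2))
        (lt_min hρ (half_pos (hδ i)))
      rw [dist_comm, lt_min_iff] at ha
      obtain ⟨g, hg, hgT, hgn⟩ := ih (δ i / 2) (half_pos (hδ i))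
      have hnear : ∀ s ∈ Set.Icc (t n) (t (n + 1)), dist (F s) (F i) < min (δ i / 2) (ε / 2) :=
        fun s hs => hi hs
      have h0 : dist (g (t n)) (F i) < δ i := by
        have h1 := (hnear (t n) ⟨le_rfl, hlt.le⟩).trans_le (min_le_left _ _)
        linarith [dist_triangle (g (t n)) (F (t n)) (F i)]
      have h1 : dist a (F i) < δ i := by
        have h1 := (hnear (t (n + 1)) ⟨hlt.le, le_rfl⟩).trans_le (min_le_left _ _)
        linarith [dist_triangle a (F (t (n + 1))) (F i)]
      obtain ⟨γ, hγ⟩ := hδJ i _ hgT _ haT h0 h1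
      have hpos : (0 : ℝ) < t (n + 1) - t n := sub_pos.2 hlt
      let φ : unitInterval → ℝ := fun s => ((s : ℝ) - t n) / (t (n + 1) - t n)
      have hφ : Continuous φ := by fun_prop
      have hφ0 : φ (t n) = 0 := by simp [φ]
      have hφ1 : φ (t (n + 1)) = 1 := div_self hpos.ne'
      let G : C(unitInterval, E) := ⟨fun s => if s ≤ t n then g s else γ.extend (φ s),
        Continuous.if_le g.continuous (γ.continuous_extend.comp hφ) continuous_id continuous_const
          fun s (hs : s = t n) => by rw [hs, hφ0, γ.extend_zero]⟩
      have hG1 : G (t (n + 1)) = a := by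
        change (if t (n + 1) ≤ t n then _ else _) = _
        rw [if_neg hlt.not_ge, hφ1, γ.extend_one]
      refine ⟨G, fun s hs => ?_, by rwa [hG1], by rw [hG1]; exact ha.1⟩
      change (if s ≤ t n then g s else γ.extend (φ s)) ∈ S ∧
        dist (if s ≤ t n then g s else γ.extend (φ s)) (F s) < ε
      split_ifs with hsn
      · exact hg s hsn
      · have hs' : s ∈ Set.Icc (t n) (t (n + 1)) := ⟨(not_le.1 hsn).le, hs⟩
        have hφI : φ s ∈ unitInterval :=
          ⟨div_nonneg (sub_nonneg.2 hs'.1) hpos.le,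
            (div_le_one hpos).2 (sub_le_sub_right (show (s : ℝ) ≤ t (n + 1) from hs) _)⟩
        rw [γ.extend_apply hφI]
        refine ⟨(hγ _).1, ?_⟩
        have h2 : dist (γ ⟨φ s, hφI⟩) (F i) < ε / 2 := (hγ _).2
        have h3 := (hnear s hs').trans_le (min_le_right _ _)
        linarith [dist_triangle_right (γ ⟨φ s, hφI⟩) (F s) (F i)]
  obtain ⟨G, hG, -⟩ := hstep N 1 one_pos
  exact ⟨G, fun s => hG s (by rw [hN N le_rfl]; exact s.2.2)⟩

/-- Pairs that can be brought to a pair with invertible second entry by row operations and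
right multiplication by units. -/
inductive Reducible₂ {S : Type*} [Ring S] : S → S → Prop
  | unit (x y : S) : IsUnit y → Reducible₂ x y
  | addl (c x y : S) : Reducible₂ (x + c * y) y → Reducible₂ x y
  | addr (c x y : S) : Reducible₂ x (y + c * x) → Reducible₂ x y
  | scale (z x y : S) : IsUnit z → Reducible₂ (x * z) (y * z) → Reducible₂ x y

namespace Reducible₂

variable {S : Type*} [NormedRing S]

theorem of_isUnit_left {x : S} (hx : IsUnit x) (y : S) : Reducible₂ x y := by
  obtain ⟨u, rfl⟩ := hx
  refine .addr ((1 - y) * ↑u⁻¹) _ _ (.unit _ _ ?_)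
  rw [mul_assoc, Units.inv_mul, mul_one, add_sub_cancel]
  exact isUnit_one

theorem closure_addl {c x y : S} (h : (x + c * y, y) ∈ closure {p : S × S | Reducible₂ p.1 p.2}) :
    (x, y) ∈ closure {p : S × S | Reducible₂ p.1 p.2} := by
  have h1 := map_mem_closure (f := fun p : S × S => (p.1 - c * p.2, p.2)) (by fun_prop) h
    (t := {p : S × S | Reducible₂ p.1 p.2}) fun p hp => .addl c _ _ (by simpa using hp)
  simpa using h1

theorem closure_addr {c x y : S} (h : (x, y + c * x) ∈ closure {p : S × S | Reducible₂ p.1 p.2}) :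
    (x, y) ∈ closure {p : S × S | Reducible₂ p.1 p.2} := by
  have h1 := map_mem_closure (f := fun p : S × S => (p.1, p.2 - c * p.1)) (by fun_prop) h
    (t := {p : S × S | Reducible₂ p.1 p.2}) fun p hp => .addr c _ _ (by simpa using hp)
  simpa using h1

theorem closure_scale {z x y : S} (hz : IsUnit z)
    (h : (x * z, y * z) ∈ closure {p : S × S | Reducible₂ p.1 p.2}) :
    (x, y) ∈ closure {p : S × S | Reducible₂ p.1 p.2} := by
  obtain ⟨u, rfl⟩ := hz
  have h1 := map_mem_closure (f := fun p : S × S => (p.1 * ↑u⁻¹, p.2 * ↑u⁻¹)) (by fun_prop) h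
    (t := {p : S × S | Reducible₂ p.1 p.2}) fun p hp => .scale (u : S) _ _ u.isUnit
      (by simpa [mul_assoc] using hp)
  simpa [mul_assoc] using h1

variable [NormedAlgebra ℂ S]

theorem zero_mem_closure_units : (0 : S) ∈ closure {x : S | IsUnit x} := by
  have hd : Dense ({0}ᶜ : Set ℂ) := dense_compl_singleton 0
  have h1 := map_mem_closure (f := fun s : ℂ => s • (1 : S)) (by fun_prop) (hd 0)
    (t := {x : S | IsUnit x}) fun s hs => by
      simpa [Algebra.algebraMap_eq_smul_one] using
        (IsUnit.mk0 s hs).map (algebraMap ℂ S)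
  simpa using h1

theorem closure_zero_right (x : S) : (x, 0) ∈ closure {p : S × S | Reducible₂ p.1 p.2} :=
  map_mem_closure (f := fun y : S => (x, y)) (by fun_prop) zero_mem_closure_units
    fun y hy => .unit _ _ hy

theorem closure_zero_left (y : S) : (0, y) ∈ closure {p : S × S | Reducible₂ p.1 p.2} :=
  map_mem_closure (f := fun x : S => (x, y)) (by fun_prop) zero_mem_closure_units
    fun x hx => of_isUnit_left hx y

end Reducible₂

section Circle

variable {R : Type*} [NormedRing R] [NormedAlgebra ℂ R]

/-- The monomial `z ^ n • r` on the circle. -/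
def circleMonomial (n : ℤ) (r : R) : C(AddCircle (1 : ℝ), R) :=
  ⟨fun t => fourier n t • r, by fun_prop⟩

@[simp] theorem circleMonomial_apply (n : ℤ) (r : R) (t : AddCircle (1 : ℝ)) :
    circleMonomial n r t = fourier n t • r := rfl

theorem circleMonomial_mul (m n : ℤ) (r s : R) :
    circleMonomial m r * circleMonomial n s = circleMonomial (m + n) (r * s) := by
  ext t
  rw [ContinuousMap.mul_apply, circleMonomial_apply, circleMonomial_apply, circleMonomial_apply,
    smul_mul_smul_comm, fourier_add]

theorem circleMonomial_zero_one : circleMonomial 0 (1 : R) = 1 := by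
  ext t
  simp

theorem circleMonomial_isUnit (n : ℤ) : IsUnit (circleMonomial n (1 : R)) :=
  isUnit_iff_exists.2 ⟨circleMonomial (-n) 1,
    by simp [circleMonomial_mul, circleMonomial_zero_one],
    by simp [circleMonomial_mul, circleMonomial_zero_one]⟩

/-- `circleMonomial` as an additive homomorphism. -/
def circleMonomialHom (R : Type*) [NormedRing R] [NormedAlgebra ℂ R] (n : ℤ) :
    R →+ C(AddCircle (1 : ℝ), R) where
  toFun := circleMonomial n
  map_zero' := by ext; simp
  map_add' r s := by ext; simp

theorem circleMonomial_neg (n : ℤ) (r : R) : circleMonomial n (-r) = -circleMonomial n r := by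
  ext
  simp

theorem continuous_circleMonomial (n : ℤ) : Continuous (circleMonomial n : R → _) := by
  refine ContinuousMap.continuous_of_continuous_uncurry _ ?_
  simp only [Function.uncurry_def, circleMonomial_apply]
  fun_prop

/-- Polynomial functions on the circle of degree less than `n`. -/
def circlePoly (R : Type*) [NormedRing R] [NormedAlgebra ℂ R] :
    ℕ → AddSubgroup C(AddCircle (1 : ℝ), R)
  | 0 => ⊥
  | n + 1 => circlePoly R n ⊔ (circleMonomialHom R n).range

theorem mem_circlePoly_succ {n : ℕ} {f : C(AddCircle (1 : ℝ), R)} :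
    f ∈ circlePoly R (n + 1) ↔ ∃ g ∈ circlePoly R n, ∃ r, g + circleMonomial n r = f := by
  simp only [circlePoly, AddSubgroup.mem_sup, AddMonoidHom.mem_range, exists_exists_eq_and]
  rfl

theorem circlePoly_mono : Monotone (circlePoly R) :=
  monotone_nat_of_le_succ fun _ => le_sup_left

theorem circleMonomial_mul_mem {m k : ℕ} (c : R) {g : C(AddCircle (1 : ℝ), R)}
    (hg : g ∈ circlePoly R m) : circleMonomial k c * g ∈ circlePoly R (m + k) := by
  induction m generalizing g with
  | zero =>
    rw [AddSubgroup.mem_bot.1 hg, mul_zero]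
    exact zero_mem _
  | succ m ih =>
    obtain ⟨g, hg', r, rfl⟩ := mem_circlePoly_succ.1 hg
    rw [show m + 1 + k = m + k + 1 by ring]
    refine mem_circlePoly_succ.2 ⟨_, ih hg', c * r, ?_⟩
    rw [mul_add, circleMonomial_mul, Nat.cast_add, add_comm (m : ℤ)]

theorem Reducible₂.closure_of_mem_circlePoly (hR : Dense {x : R | IsUnit x}) {n m : ℕ}
    {f g : C(AddCircle (1 : ℝ), R)} (hf : f ∈ circlePoly R n) (hg : g ∈ circlePoly R m) :
    (f, g) ∈ closure {p : C(AddCircle (1 : ℝ), R) × C(AddCircle (1 : ℝ), R) |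
      Reducible₂ p.1 p.2} := by
  induction hN : n + m using Nat.strong_induction_on generalizing n m f g with
  | _ N ih =>
  subst hN
  rcases n with _ | n
  · rw [AddSubgroup.mem_bot.1 hf]
    exact closure_zero_left _
  rcases m with _ | m
  · rw [AddSubgroup.mem_bot.1 hg]
    exact closure_zero_right _
  obtain ⟨f, hf', a, rfl⟩ := mem_circlePoly_succ.1 hf
  obtain ⟨g, hg', b, rfl⟩ := mem_circlePoly_succ.1 hg
  rw [← closure_closure]
  rcases le_total m n with hmn | hmn
  · refine map_mem_closure (f := fun b : R => (f + circleMonomial n a, g + circleMonomial m b))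
      (continuous_const.prodMk (continuous_const.add (continuous_circleMonomial _))) (hR b) ?_
    rintro _ ⟨b, rfl⟩
    refine closure_addl (c := circleMonomial (n - m : ℕ) (-(a * (↑b⁻¹ : R)))) ?_
    refine ih (n + (m + 1)) (by omega) ?_ (mem_circlePoly_succ.2 ⟨g, hg', _, rfl⟩) rfl
    have h1 : f + circleMonomial n a + circleMonomial (n - m : ℕ) (-(a * (↑b⁻¹ : R))) *
        (g + circleMonomial m (b : R)) =
        f + circleMonomial (n - m : ℕ) (-(a * (↑b⁻¹ : R))) * g := by
      rw [mul_add, circleMonomial_mul, neg_mul, mul_assoc, Units.inv_mul, mul_one,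
        ← Nat.cast_add, Nat.sub_add_cancel hmn, circleMonomial_neg n a]
      abel
    rw [h1]
    refine add_mem hf' ?_
    simpa [Nat.add_sub_cancel' hmn] using circleMonomial_mul_mem (k := n - m) (-(a * (↑b⁻¹ : R))) hg'
  · refine map_mem_closure (f := fun a : R => (f + circleMonomial n a, g + circleMonomial m b))
      ((continuous_const.add (continuous_circleMonomial _)).prodMk continuous_const) (hR a) ?_
    rintro _ ⟨a, rfl⟩
    refine closure_addr (c := circleMonomial (m - n : ℕ) (-(b * (↑a⁻¹ : R)))) ?_
    refine ih (n + 1 + m) (by omega) (mem_circlePoly_succ.2 ⟨f, hf', _, rfl⟩) ?_ rfl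
    have h1 : g + circleMonomial m b + circleMonomial (m - n : ℕ) (-(b * (↑a⁻¹ : R))) *
        (f + circleMonomial n (a : R)) =
        g + circleMonomial (m - n : ℕ) (-(b * (↑a⁻¹ : R))) * f := by
      rw [mul_add, circleMonomial_mul, neg_mul, mul_assoc, Units.inv_mul, mul_one,
        ← Nat.cast_add, Nat.sub_add_cancel hmn, circleMonomial_neg m b]
      abel
    rw [h1]
    refine add_mem hg' ?_
    simpa [Nat.add_sub_cancel' hmn] using circleMonomial_mul_mem (k := m - n) (-(b * (↑a⁻¹ : R))) hf'


/-- Trigonometric polynomials with coefficients in `R`. -/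
def circleTrig (R : Type*) [NormedRing R] [NormedAlgebra ℂ R] :
    AddSubgroup C(AddCircle (1 : ℝ), R) :=
  AddSubgroup.closure {f | ∃ n r, f = circleMonomial n r}

theorem circleMonomial_mem_circlePoly (n : ℕ) (r : R) :
    circleMonomial n r ∈ circlePoly R (n + 1) :=
  mem_circlePoly_succ.2 ⟨0, zero_mem _, r, zero_add _⟩

theorem exists_mul_mem_circlePoly {f : C(AddCircle (1 : ℝ), R)} (hf : f ∈ circleTrig R) :
    ∃ N : ℕ, ∀ k : ℕ, N ≤ k → ∃ n, f * circleMonomial k 1 ∈ circlePoly R n := by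
  induction hf using AddSubgroup.closure_induction with
  | mem f hf =>
    obtain ⟨n, r, rfl⟩ := hf
    refine ⟨n.natAbs, fun k hk => ⟨(n + k).toNat + 1, ?_⟩⟩
    have h := circleMonomial_mem_circlePoly (n + k).toNat r
    rw [Int.toNat_of_nonneg (by omega)] at h
    rwa [circleMonomial_mul, mul_one]
  | zero => exact ⟨0, fun k _ => ⟨0, by rw [zero_mul]; exact zero_mem _⟩⟩
  | add f g _ _ hf hg =>
    obtain ⟨N, hN⟩ := hf
    obtain ⟨M, hM⟩ := hg
    refine ⟨max N M, fun k hk => ?_⟩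
    obtain ⟨n, hn⟩ := hN k ((le_max_left _ _).trans hk)
    obtain ⟨m, hm⟩ := hM k ((le_max_right _ _).trans hk)
    refine ⟨max n m, ?_⟩
    rw [add_mul]
    exact add_mem (circlePoly_mono (le_max_left _ _) hn) (circlePoly_mono (le_max_right _ _) hm)
  | neg f _ hf =>
    obtain ⟨N, hN⟩ := hf
    refine ⟨N, fun k hk => ?_⟩
    obtain ⟨n, hn⟩ := hN k hk
    refine ⟨n, ?_⟩
    convert neg_mem hn using 1
    ext t
    simp

/-- The function `t ↦ h t • r`. -/
def circleSmul (r : R) (h : C(AddCircle (1 : ℝ), ℂ)) : C(AddCircle (1 : ℝ), R) :=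
  ⟨fun t => h t • r, by fun_prop⟩

theorem continuous_circleSmul (r : R) : Continuous (circleSmul r) := by
  refine ContinuousMap.continuous_of_continuous_uncurry _ ?_
  simp only [Function.uncurry_def, circleSmul, ContinuousMap.coe_mk]
  fun_prop

theorem circleSmul_mem (r : R) (h : C(AddCircle (1 : ℝ), ℂ)) :
    circleSmul r h ∈ closure (circleTrig R : Set C(AddCircle (1 : ℝ), R)) := by
  have hh : h ∈ closure (Submodule.span ℂ (Set.range (fourier (T := 1))) :
      Set C(AddCircle (1 : ℝ), ℂ)) := by
    have : h ∈ (Submodule.span ℂ (Set.range (fourier (T := 1)))).topologicalClosure := by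
      rw [span_fourier_closure_eq_top]
      trivial
    exact this
  refine map_mem_closure (continuous_circleSmul r) hh fun p hp => ?_
  change circleSmul r p ∈ circleTrig R
  suffices ∀ r : R, circleSmul r p ∈ circleTrig R from this r
  induction hp using Submodule.span_induction with
  | mem p hp =>
    obtain ⟨n, rfl⟩ := hp
    exact fun r => AddSubgroup.subset_closure ⟨n, r, rfl⟩
  | zero =>
    intro r
    convert zero_mem (circleTrig R)
    ext t
    simp [circleSmul]
  | add p q _ _ hp hq =>
    intro r
    convert add_mem (hp r) (hq r) using 1
    ext t
    simp [circleSmul, add_smul]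
  | smul c p _ hp =>
    intro r
    convert hp (c • r) using 1
    ext t
    simp [circleSmul, smul_smul, mul_comm]

theorem dense_circleTrig : Dense (circleTrig R : Set C(AddCircle (1 : ℝ), R)) := by
  intro f
  rw [← closure_closure, Metric.mem_closure_iff]
  intro ε hε
  let U : AddCircle (1 : ℝ) → Set (AddCircle (1 : ℝ)) := fun s => {t | dist (f t) (f s) < ε / 2}
  have hU : ∀ s, IsOpen (U s) := fun s => isOpen_lt (by fun_prop) continuous_const
  obtain ⟨J, hJ⟩ := isCompact_univ.elim_finite_subcover U hU fun t _ =>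
    Set.mem_iUnion.2 ⟨t, show dist (f t) (f t) < _ by rw [dist_self]; exact half_pos hε⟩
  obtain ⟨ρ, hρ⟩ := PartitionOfUnity.exists_isSubordinate isClosed_univ (fun i : J => U i)
    (fun i => hU i) (by simpa [Set.iUnion_subtype] using hJ)
  have hsum : ∀ t, ∑ i, ρ i t = 1 := fun t => by
    rw [← finsum_eq_sum_of_fintype]
    exact ρ.sum_eq_one (Set.mem_univ t)
  let g : C(AddCircle (1 : ℝ), R) :=
    ∑ i : J, circleSmul (f i) ⟨fun t => (ρ i t : ℂ), by fun_prop⟩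
  refine ⟨g, ?_, ?_⟩
  · exact sum_mem (S := (circleTrig R).topologicalClosure) fun i _ => circleSmul_mem _ _
  · refine lt_of_le_of_lt ((ContinuousMap.dist_le (half_pos hε).le).2 fun t => ?_)
      (half_lt_self hε)
    have hg : g t = ∑ i : J, ρ i t • f i := by
      simp [g, circleSmul, ContinuousMap.sum_apply, Complex.coe_smul]
    have hf : f t = ∑ i : J, ρ i t • f t := by
      rw [← Finset.sum_smul, hsum, one_smul]
    rw [dist_eq_norm, hg]
    conv_lhs => rw [hf]
    rw [← Finset.sum_sub_distrib]
    calc ‖∑ i : J, (ρ i t • f t - ρ i t • f i)‖ ≤ ∑ i : J, ρ i t * (ε / 2) := by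
          refine norm_sum_le_of_le _ fun i _ => ?_
          rw [← smul_sub, norm_smul, Real.norm_of_nonneg (ρ.nonneg i t)]
          by_cases h0 : ρ i t = 0
          · simp [h0]
          · have h1 : t ∈ U i := hρ i (subset_tsupport _ h0)
            have h2 : ‖f t - f i‖ < ε / 2 := by rw [← dist_eq_norm]; exact h1
            exact mul_le_mul_of_nonneg_left h2.le (ρ.nonneg i t)
      _ = ε / 2 := by rw [← Finset.sum_mul, hsum, one_mul]

theorem dense_reducible₂ (hR : Dense {x : R | IsUnit x}) :
    Dense {p : C(AddCircle (1 : ℝ), R) × C(AddCircle (1 : ℝ), R) | Reducible₂ p.1 p.2} := by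
  have hd := (dense_circleTrig (R := R)).prod (dense_circleTrig (R := R))
  rw [← dense_closure]
  refine hd.mono ?_
  rintro ⟨f, g⟩ ⟨hf, hg⟩
  obtain ⟨N, hN⟩ := exists_mul_mem_circlePoly hf
  obtain ⟨M, hM⟩ := exists_mul_mem_circlePoly hg
  obtain ⟨n, hn⟩ := hN (max N M) (le_max_left _ _)
  obtain ⟨m, hm⟩ := hM (max N M) (le_max_right _ _)
  exact Reducible₂.closure_scale (circleMonomial_isUnit _)
    (Reducible₂.closure_of_mem_circlePoly hR hn hm)

end Circle

section

open Matrix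

section Blocks

variable {R : Type*} [Ring R] {ι κ : Type*} [Fintype ι] [DecidableEq ι] [Fintype κ] [DecidableEq κ]

theorem Matrix.isUnit_of_isUnit_fromBlocks_zero {A : Matrix ι ι R} {B : Matrix ι κ R}
    {D : Matrix κ κ R} (h : IsUnit (fromBlocks A B 0 D)) (hD : IsUnit D) : IsUnit A := by
  obtain ⟨N, h1, h2⟩ := isUnit_iff_exists.1 h
  rw [← fromBlocks_toBlocks N, fromBlocks_multiply, ← fromBlocks_one, fromBlocks_inj] at h1 h2
  have h3 : N.toBlocks₂₁ = 0 := by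
    have := h1.2.2.1
    rw [Matrix.zero_mul, zero_add] at this
    obtain ⟨E, hE⟩ := hD.exists_left_inv
    calc N.toBlocks₂₁ = E * D * N.toBlocks₂₁ := by rw [hE, Matrix.one_mul]
      _ = 0 := by rw [Matrix.mul_assoc, this, Matrix.mul_zero]
  refine isUnit_iff_exists.2 ⟨N.toBlocks₁₁, ?_, ?_⟩
  · simpa [h3] using h1.1
  · simpa using h2.1

theorem Matrix.isUnit_fromBlocks_one_zero (C : Matrix κ ι R) :
    IsUnit (fromBlocks (1 : Matrix ι ι R) 0 C (1 : Matrix κ κ R)) :=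
  isUnit_iff_exists.2 ⟨fromBlocks 1 0 (-C) 1, by simp [fromBlocks_multiply],
    by simp [fromBlocks_multiply]⟩

theorem Matrix.isUnit_fromBlocks_one_zero' (B : Matrix ι κ R) :
    IsUnit (fromBlocks (1 : Matrix ι ι R) B 0 (1 : Matrix κ κ R)) :=
  isUnit_iff_exists.2 ⟨fromBlocks 1 (-B) 0 1, by simp [fromBlocks_multiply],
    by simp [fromBlocks_multiply]⟩

theorem Matrix.isUnit_fromBlocks_diagonal {A : Matrix ι ι R} {D : Matrix κ κ R} (hA : IsUnit A)
    (hD : IsUnit D) : IsUnit (fromBlocks A 0 0 D) := by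
  obtain ⟨A', h1, h2⟩ := isUnit_iff_exists.1 hA
  obtain ⟨D', h3, h4⟩ := isUnit_iff_exists.1 hD
  exact isUnit_iff_exists.2 ⟨fromBlocks A' 0 0 D', by simp [fromBlocks_multiply, h1, h3],
    by simp [fromBlocks_multiply, h2, h4]⟩

theorem Matrix.isUnit_schur {A : Matrix ι ι R} {B : Matrix ι κ R} {C : Matrix κ ι R}
    {D D' : Matrix κ κ R} (h : IsUnit (fromBlocks A B C D)) (h1 : D * D' = 1) (h2 : D' * D = 1) :
    IsUnit (A - B * D' * C) := by
  have h3 := h.mul (isUnit_fromBlocks_one_zero (-(D' * C)))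
  rw [fromBlocks_multiply] at h3
  refine isUnit_of_isUnit_fromBlocks_zero (B := B) (D := D) ?_ (isUnit_iff_exists.2 ⟨D', h1, h2⟩)
  convert h3 using 2
  · simp [sub_eq_add_neg, Matrix.mul_assoc]
  · simp
  · simp [← Matrix.mul_assoc, h1]
  · simp

theorem Matrix.isUnit_one_add_single {i j : ι} (hij : i ≠ j) (c : R) :
    IsUnit (1 + single i j c) :=
  isUnit_iff_exists.2 ⟨1 + single i j (-c),
    by simp [mul_add, add_mul, single_mul_single_of_ne _ _ _ _ hij.symm, add_assoc, ← single_add],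
    by simp [mul_add, add_mul, single_mul_single_of_ne _ _ _ _ hij.symm, add_assoc, ← single_add]⟩

theorem Matrix.one_add_single_mul_apply (i j : ι) (c : R) (M : Matrix ι ι R) (k l : ι) :
    ((1 + single i j c) * M) k l = M k l + if k = i then c * M j l else 0 := by
  rw [add_mul, one_mul, add_apply]
  split_ifs with h
  · subst h
    simp
  · simp [h]

end Blocks

section Descent

theorem coe_one_eq_coe_zero_addCircle :
    (((1 : unitInterval) : ℝ) : AddCircle (1 : ℝ)) = (((0 : unitInterval) : ℝ) : AddCircle (1 : ℝ)) :=
  (AddCircle.coe_period 1).trans (QuotientAddGroup.mk_zero _).symm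

theorem Matrix.continuous_single {R ι κ : Type*} [Zero R] [TopologicalSpace R] [DecidableEq ι]
    [DecidableEq κ] (i : ι) (j : κ) : Continuous (single i j : R → Matrix ι κ R) :=
  continuous_matrix fun k l => by
    simp only [single_apply]
    split_ifs <;> fun_prop

variable {R : Type*} [CStarAlgebra R] {ι : Type*} [Fintype ι] [DecidableEq ι]

theorem Matrix.isOpen_isUnit : IsOpen {M : Matrix ι ι R | IsUnit M} := by
  let : PartialOrder R := CStarAlgebra.spectralOrder R
  have : StarOrderedRing R := CStarAlgebra.spectralOrderedRing R
  exact Units.isOpen (R := CStarMatrix ι ι R)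

theorem joinedIn_isUnit_of_reducible₂ (W : Matrix ι ι R) (i : ι)
    {x y : C(AddCircle (1 : ℝ), R)} (h : Reducible₂ x y) :
    ∀ M : unitInterval → Matrix (ι ⊕ Unit) (ι ⊕ Unit) R, Continuous M → (∀ t, IsUnit (M t)) →
      M 1 = M 0 * fromBlocks W 0 0 1 → (∀ t : unitInterval, M t (.inl i) (.inr ()) = x (t : ℝ)) →
      (∀ t : unitInterval, M t (.inr ()) (.inr ()) = y (t : ℝ)) →
      JoinedIn {N : Matrix ι ι R | IsUnit N} 1 W := by
  induction h with
  | unit x y hy =>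
    intro M hM hu h01 hx hyM
    obtain ⟨y', h1, h2⟩ := isUnit_iff_exists.1 hy
    let E : unitInterval → Matrix Unit Unit R := fun t => of fun _ _ => y' (t : ℝ)
    have hE : Continuous E := continuous_matrix fun _ _ => by
      simp only [E, of_apply]
      fun_prop
    have hD1 : ∀ t, (M t).toBlocks₂₂ * E t = 1 := fun t => by
      ext a b
      simp only [mul_apply, toBlocks₂₂, E, of_apply, Finset.univ_unique, Finset.sum_singleton]
      change M t (.inr ()) (.inr ()) * _ = _
      rw [hyM, ← ContinuousMap.mul_apply, h1]
      simp
    have hD2 : ∀ t, E t * (M t).toBlocks₂₂ = 1 := fun t => by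
      ext a b
      simp only [mul_apply, toBlocks₂₂, E, of_apply, Finset.univ_unique, Finset.sum_singleton]
      change _ * M t (.inr ()) (.inr ()) = _
      rw [hyM, ← ContinuousMap.mul_apply, h2]
      simp
    let p : unitInterval → Matrix ι ι R := fun t =>
      (M t).toBlocks₁₁ - (M t).toBlocks₁₂ * E t * (M t).toBlocks₂₁
    have hp : Continuous p := by
      have e1 : Continuous fun t => (M t).toBlocks₁₁ :=
        continuous_matrix fun _ _ => hM.matrix_elem _ _
      have e2 : Continuous fun t => (M t).toBlocks₁₂ :=
        continuous_matrix fun _ _ => hM.matrix_elem _ _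
      have e3 : Continuous fun t => (M t).toBlocks₂₁ :=
        continuous_matrix fun _ _ => hM.matrix_elem _ _
      exact e1.sub ((e2.matrix_mul hE).matrix_mul e3)
    have hpu : ∀ t, IsUnit (p t) := fun t =>
      isUnit_schur (by rw [fromBlocks_toBlocks]; exact hu t) (hD1 t) (hD2 t)
    have hE01 : E 1 = E 0 := by
      ext a b
      simp only [E, of_apply, coe_one_eq_coe_zero_addCircle]
    have hp1 : p 1 = p 0 * W := by
      have h3 := h01
      rw [← fromBlocks_toBlocks (M 1), ← fromBlocks_toBlocks (M 0), fromBlocks_multiply,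
        fromBlocks_inj] at h3
      simp only [Matrix.mul_zero, add_zero, zero_add, Matrix.mul_one] at h3
      simp only [p, h3.1, h3.2.1, h3.2.2.1, hE01, Matrix.sub_mul, Matrix.mul_assoc]
    obtain ⟨q, hq1, hq2⟩ := isUnit_iff_exists.1 (hpu 0)
    refine ⟨⟨⟨fun t => q * p t, continuous_const.matrix_mul hp⟩, hq2, ?_⟩, fun t => ?_⟩
    · change q * p 1 = W
      rw [hp1, ← Matrix.mul_assoc, hq2, Matrix.one_mul]
    · exact (isUnit_iff_exists.2 ⟨p 0, hq2, hq1⟩).mul (hpu t)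
  | addl c x y _ ih =>
    intro M hM hu h01 hx hyM
    have hc : Continuous fun t : unitInterval =>
        (1 : Matrix (ι ⊕ Unit) (ι ⊕ Unit) R) + single (.inl i) (.inr ()) (c (t : ℝ)) :=
      continuous_const.add ((continuous_single _ _).comp (by fun_prop))
    refine ih (fun t => (1 + single (.inl i) (.inr ()) (c (t : ℝ))) * M t) (hc.matrix_mul hM)
      (fun t => (isUnit_one_add_single (by simp) _).mul (hu t)) ?_ (fun t => ?_) fun t => ?_
    · rw [h01, coe_one_eq_coe_zero_addCircle, Matrix.mul_assoc]
    · rw [one_add_single_mul_apply, if_pos rfl, hx, hyM]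
      rfl
    · rw [one_add_single_mul_apply, if_neg (by simp), hyM, add_zero]
  | addr c x y _ ih =>
    intro M hM hu h01 hx hyM
    have hc : Continuous fun t : unitInterval =>
        (1 : Matrix (ι ⊕ Unit) (ι ⊕ Unit) R) + single (.inr ()) (.inl i) (c (t : ℝ)) :=
      continuous_const.add ((continuous_single _ _).comp (by fun_prop))
    refine ih (fun t => (1 + single (.inr ()) (.inl i) (c (t : ℝ))) * M t) (hc.matrix_mul hM)
      (fun t => (isUnit_one_add_single (by simp) _).mul (hu t)) ?_ (fun t => ?_) fun t => ?_
    · rw [h01, coe_one_eq_coe_zero_addCircle, Matrix.mul_assoc]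
    · rw [one_add_single_mul_apply, if_neg (by simp), hx, add_zero]
    · rw [one_add_single_mul_apply, if_pos rfl, hx, hyM]
      rfl
  | scale z x y hz _ ih =>
    intro M hM hu h01 hx hyM
    let Z : unitInterval → Matrix (ι ⊕ Unit) (ι ⊕ Unit) R := fun t =>
      fromBlocks 1 0 0 (of fun _ _ => z (t : ℝ))
    have hZc : Continuous Z := by
      refine Continuous.matrix_fromBlocks continuous_const continuous_const continuous_const
        (continuous_matrix fun _ _ => ?_)
      simp only [of_apply]
      fun_prop
    have hZ01 : Z 1 = Z 0 := by
      simp only [Z, coe_one_eq_coe_zero_addCircle]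
    have hZu : ∀ t, IsUnit (Z t) := fun t => by
      obtain ⟨z', h1, h2⟩ := isUnit_iff_exists.1 hz
      refine isUnit_fromBlocks_diagonal isUnit_one
        (isUnit_iff_exists.2 ⟨of fun _ _ => z' (t : ℝ), ?_, ?_⟩)
      · ext a b
        simp [mul_apply, ← ContinuousMap.mul_apply, h1]
      · ext a b
        simp [mul_apply, ← ContinuousMap.mul_apply, h2]
    refine ih (fun t => M t * Z t) (hM.matrix_mul hZc) (fun t => (hu t).mul (hZu t)) ?_
      (fun t => ?_) fun t => ?_
    · rw [hZ01, h01, Matrix.mul_assoc, Matrix.mul_assoc]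
      congr 1
      simp [Z, fromBlocks_multiply]
    · simp [mul_apply, Z, hx]
    · simp [mul_apply, Z, hyM]

end Descent

end

section

open Matrix

theorem exists_circle_lift {R : Type*} [TopologicalSpace R] (f : C(unitInterval, R))
    (h : f 0 = f 1) : ∃ x : C(AddCircle (1 : ℝ), R), ∀ t : unitInterval, x (t : ℝ) = f t := by
  let g : ℝ → R := Set.IccExtend zero_le_one f
  have hg : Continuous g := f.continuous.Icc_extend'
  have hgI : ∀ t : unitInterval, g t = f t := fun t => Set.IccExtend_val _ _ t
  have h01 : g 0 = g (0 + 1) := by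
    rw [zero_add]
    exact (hgI 0).trans (h.trans (hgI 1).symm)
  refine ⟨⟨AddCircle.liftIco 1 0 g, AddCircle.liftIco_continuous h01 hg.continuousOn⟩, fun t => ?_⟩
  have hlt : ∀ t : unitInterval, (t : ℝ) < 1 → AddCircle.liftIco 1 0 g (t : ℝ) = f t :=
    fun t ht => by rw [AddCircle.liftIco_zero_coe_apply ⟨t.2.1, ht⟩, hgI]
  change AddCircle.liftIco 1 0 g (t : ℝ) = f t
  rcases t.2.2.lt_or_eq with ht | ht
  · exact hlt t ht
  · have : t = 1 := Subtype.ext ht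
    rw [this, coe_one_eq_coe_zero_addCircle, hlt 0 zero_lt_one, h]

section Descent

variable {R : Type*} [CStarAlgebra R] {ι : Type*} [Fintype ι] [DecidableEq ι]

/-- A stably trivial invertible matrix over a ring with dense invertibles can be
destabilized by one step. -/
theorem joinedIn_isUnit_of_fromBlocks [Nonempty ι] (hR : Dense {x : R | IsUnit x})
    (W : Matrix ι ι R)
    (h : JoinedIn {N : Matrix (ι ⊕ Unit) (ι ⊕ Unit) R | IsUnit N} 1 (fromBlocks W 0 0 1)) :
    JoinedIn {N : Matrix ι ι R | IsUnit N} 1 W := by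
  obtain ⟨γ, hγ⟩ := h
  let i : ι := Classical.arbitrary ι
  let e : R × R → Matrix (ι ⊕ Unit) (ι ⊕ Unit) R := fun p =>
    single (.inl i) (.inr ()) p.1 + single (.inr ()) (.inr ()) p.2
  have he : Continuous e := ((continuous_single _ _).comp continuous_fst).add
    ((continuous_single _ _).comp continuous_snd)
  have heW : ∀ p, e p * fromBlocks W 0 0 1 = e p := fun p => by
    ext k l
    rcases l with l | l
    · simp [e, mul_apply, single_apply]
    · simp [e, mul_apply, single_apply]
  let n : Set (unitInterval × (R × R)) := {q | IsUnit (γ q.1 + e q.2)}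
  have hn : IsOpen n := isOpen_isUnit.preimage (f := fun q : unitInterval × (R × R) =>
    γ q.1 + e q.2) (by fun_prop)
  obtain ⟨u, v, -, hv, hu, hv0, huv⟩ := generalized_tube_lemma (isCompact_univ (X := unitInterval))
    (isCompact_singleton (x := (0 : R × R))) hn (by
      rintro ⟨t, p⟩ ⟨-, hp⟩
      obtain rfl : p = 0 := hp
      change IsUnit (γ t + e 0)
      simpa [e] using hγ t)
  obtain ⟨δ, hδ, hδv⟩ := Metric.isOpen_iff.1 hv 0 (hv0 rfl)
  obtain ⟨x, hx⟩ := exists_circle_lift (R := R)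
    ⟨fun t => γ t (.inl i) (.inr ()), γ.continuous.matrix_elem _ _⟩ (by simp)
  obtain ⟨y, hy⟩ := exists_circle_lift (R := R)
    ⟨fun t => γ t (.inr ()) (.inr ()), γ.continuous.matrix_elem _ _⟩ (by simp)
  obtain ⟨⟨x', y'⟩, hr, hd⟩ := Metric.mem_closure_iff.1 (dense_reducible₂ hR (x, y)) δ hδ
  let d : unitInterval → R × R := fun t => (x' (t : ℝ) - x (t : ℝ), y' (t : ℝ) - y (t : ℝ))
  have hdc : Continuous d := by fun_prop
  have hd01 : d 1 = d 0 := by simp only [d, coe_one_eq_coe_zero_addCircle]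
  have hdv : ∀ t, d t ∈ v := fun t => hδv <| by
    rw [mem_ball_zero_iff, Prod.norm_mk, max_lt_iff]
    rw [dist_comm, Prod.dist_eq, max_lt_iff] at hd
    simp only [← dist_eq_norm]
    exact ⟨(ContinuousMap.dist_apply_le_dist _).trans_lt hd.1,
      (ContinuousMap.dist_apply_le_dist _).trans_lt hd.2⟩
  refine joinedIn_isUnit_of_reducible₂ W i (x := x') (y := y') hr (fun t => γ t + e (d t))
    (by fun_prop) (fun t => huv (Set.mk_mem_prod (hu trivial) (hdv t))) ?_ (fun t => ?_) fun t => ?_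
  · rw [γ.source, γ.target, add_mul, heW, hd01, one_mul]
  · have h1 := hx t
    simp only [ContinuousMap.coe_mk] at h1
    simp [e, d, h1]
  · have h1 := hy t
    simp only [ContinuousMap.coe_mk] at h1
    simp [e, d, h1]

theorem JoinedIn.reindex_isUnit {κ : Type*} [Fintype κ] [DecidableEq κ] (e : ι ≃ κ)
    {M N : Matrix ι ι R} (h : JoinedIn {N : Matrix ι ι R | IsUnit N} M N) :
    JoinedIn {N : Matrix κ κ R | IsUnit N} (M.submatrix e.symm e.symm)
      (N.submatrix e.symm e.symm) := by
  obtain ⟨γ, hγ⟩ := h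
  refine ⟨γ.map (f := fun M => M.submatrix e.symm e.symm)
    (Continuous.matrix_submatrix continuous_id _ _), fun t => ?_⟩
  exact (hγ t).map (Matrix.reindexAlgEquiv ℂ R e)

theorem joinedIn_isUnit_of_fromBlocks_fin [Nonempty ι] (hR : Dense {x : R | IsUnit x})
    (W : Matrix ι ι R) (k : ℕ)
    (h : JoinedIn {N : Matrix (ι ⊕ Fin k) (ι ⊕ Fin k) R | IsUnit N} 1 (fromBlocks W 0 0 1)) :
    JoinedIn {N : Matrix ι ι R | IsUnit N} 1 W := by
  induction k with
  | zero =>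
    convert h.reindex_isUnit (Equiv.sumEmpty ι (Fin 0)) using 1
    · simp
    · ext a b
      simp
  | succ k ih =>
    refine ih (joinedIn_isUnit_of_fromBlocks hR _ ?_)
    convert h.reindex_isUnit (((Equiv.refl ι).sumCongr (finSumFinEquiv.symm.trans
      ((Equiv.refl (Fin k)).sumCongr (Equiv.ofUnique (Fin 1) Unit)))).trans
        (Equiv.sumAssoc ι (Fin k) Unit).symm) using 1
    · rw [submatrix_one_equiv]
    · ext a b
      rcases a with (a | a) | a <;> rcases b with (b | b) | b <;>
        simp [one_apply, Fin.ext_iff]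
      · omega
      · omega

theorem JoinedIn.fromBlocks_isUnit (hR : Dense {x : R | IsUnit x})
    (h1 : ∀ r : R, IsUnit r → JoinedIn {x : R | IsUnit x} 1 r)
    (hι : ∀ M : Matrix ι ι R, IsUnit M → JoinedIn {N : Matrix ι ι R | IsUnit N} 1 M)
    (M : Matrix (ι ⊕ Unit) (ι ⊕ Unit) R) (hM : IsUnit M) :
    JoinedIn {N : Matrix (ι ⊕ Unit) (ι ⊕ Unit) R | IsUnit N} 1 M := by
  let f : R → Matrix (ι ⊕ Unit) (ι ⊕ Unit) R := fun d => M + single (.inr ()) (.inr ()) d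
  have hf : Continuous f := continuous_const.add (continuous_single _ _)
  obtain ⟨ε, hε, hεf⟩ := Metric.isOpen_iff.1 (isOpen_isUnit.preimage hf) 0
    (by simpa [f] using hM)
  obtain ⟨d, hd, hdist⟩ := Metric.mem_closure_iff.1 (hR (M (.inr ()) (.inr ()))) ε hε
  set c := d - M (.inr ()) (.inr ()) with hc
  have hcε : ‖c‖ < ε := by rwa [hc, ← dist_eq_norm, dist_comm]
  have hpath : JoinedIn {N : Matrix (ι ⊕ Unit) (ι ⊕ Unit) R | IsUnit N} (f c) M := by
    refine JoinedIn.symm (JoinedIn.ofLine (f := fun t : ℝ => f (t • c)) (by fun_prop) (by simp [f])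
      (by simp) ?_)
    rintro _ ⟨t, ht, rfl⟩
    refine hεf (mem_ball_zero_iff.2 ?_)
    rw [norm_smul, Real.norm_of_nonneg ht.1]
    exact (mul_le_of_le_one_left (norm_nonneg _) ht.2).trans_lt hcε
  have hfc : IsUnit (f c) := hpath.source_mem
  refine JoinedIn.trans ?_ hpath
  obtain ⟨d', hd1, hd2⟩ := isUnit_iff_exists.1 hd
  generalize hN : f c = N at hfc
  have hNd : N (.inr ()) (.inr ()) = d := by simp [← hN, f, c]
  set A := N.toBlocks₁₁
  set B := N.toBlocks₁₂
  set C := N.toBlocks₂₁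
  set D : Matrix Unit Unit R := of fun _ _ => d with hD
  set D' : Matrix Unit Unit R := of fun _ _ => d' with hD'
  have hDN : N.toBlocks₂₂ = D := by
    ext a b
    exact hNd
  have hDD' : D * D' = 1 := by
    ext
    simp [D, D', mul_apply, hd1]
  have hD'D : D' * D = 1 := by
    ext
    simp [D, D', mul_apply, hd2]
  have hNb : N = fromBlocks A B C D := by rw [← hDN, fromBlocks_toBlocks]
  have hS : IsUnit (A - B * D' * C) := isUnit_schur (by rwa [← hNb]) hDD' hD'D
  obtain ⟨γ, hγ⟩ := hι _ hS
  obtain ⟨ρ, hρ⟩ := h1 d hd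
  have hdiag : JoinedIn {N : Matrix (ι ⊕ Unit) (ι ⊕ Unit) R | IsUnit N} 1
      (fromBlocks (A - B * D' * C) 0 0 D) := by
    refine ⟨⟨⟨fun t => fromBlocks (γ t) 0 0 (of fun _ _ => ρ t), ?_⟩, ?_, ?_⟩, fun t => ?_⟩
    · refine Continuous.matrix_fromBlocks γ.continuous continuous_const continuous_const
        (continuous_matrix fun _ _ => ?_)
      exact ρ.continuous
    · simp only [γ.source, ρ.source, ← fromBlocks_one]
      congr 1
    · simp only [γ.target, ρ.target]
      rfl
    · refine isUnit_fromBlocks_diagonal (hγ t) ?_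
      obtain ⟨z, hz1, hz2⟩ := isUnit_iff_exists.1 (hρ t)
      refine isUnit_iff_exists.2 ⟨of fun _ _ => z, ?_, ?_⟩
      · ext
        simp [mul_apply, hz1]
      · ext
        simp [mul_apply, hz2]
  refine hdiag.trans (JoinedIn.ofLine (f := fun t : ℝ => fromBlocks 1 (t • (B * D')) 0 1 *
    fromBlocks (A - B * D' * C) 0 0 D * fromBlocks 1 0 (t • (D' * C)) 1) ?_ ?_ ?_ ?_)
  · refine Continuous.continuousOn (Continuous.matrix_mul (Continuous.matrix_mul
      (Continuous.matrix_fromBlocks ?_ ?_ ?_ ?_) continuous_const)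
      (Continuous.matrix_fromBlocks ?_ ?_ ?_ ?_)) <;> fun_prop
  · simp
  · rw [hNb]
    simp [fromBlocks_multiply, Matrix.mul_assoc, hD'D]
    simp [← Matrix.mul_assoc, hDD']
  · rintro _ ⟨t, -, rfl⟩
    exact ((isUnit_fromBlocks_one_zero' _).mul (isUnit_fromBlocks_diagonal hS
      (isUnit_iff_exists.2 ⟨D', hDD', hD'D⟩))).mul (isUnit_fromBlocks_one_zero _)

theorem joinedIn_one_isUnit_fin (hR : Dense {x : R | IsUnit x})
    (h1 : ∀ r : R, IsUnit r → JoinedIn {x : R | IsUnit x} 1 r) (n : ℕ)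
    (M : Matrix (Fin n) (Fin n) R) (hM : IsUnit M) :
    JoinedIn {N : Matrix (Fin n) (Fin n) R | IsUnit N} 1 M := by
  induction n with
  | zero =>
    rw [Subsingleton.elim M 1]
    exact JoinedIn.refl isUnit_one
  | succ n ih =>
    let e : Fin (n + 1) ≃ Fin n ⊕ Unit := finSumFinEquiv.symm.trans
      ((Equiv.refl (Fin n)).sumCongr (Equiv.ofUnique (Fin 1) Unit))
    have h2 := (JoinedIn.fromBlocks_isUnit hR h1 ih (M.submatrix e.symm e.symm)
      (hM.map (Matrix.reindexAlgEquiv ℂ R e))).reindex_isUnit e.symm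
    simpa [submatrix_submatrix] using h2

end Descent

end

section

open Matrix

theorem ContinuousMap.isQuasiregular_iff {X : Type*} [TopologicalSpace X] {A : Type*}
    [NonUnitalCStarAlgebra A] (f : C(X, A)) : IsQuasiregular f ↔ ∀ t, IsQuasiregular (f t) := by
  constructor
  · intro h t
    obtain ⟨y, h1, h2⟩ := (_root_.isQuasiregular_iff).1 h
    exact (_root_.isQuasiregular_iff).2 ⟨y t, congrArg (fun g : C(X, A) => g t) h1,
      congrArg (fun g : C(X, A) => g t) h2⟩
  · intro h
    have hu : ∀ t, IsUnit (1 + Unitization.inr (f t) : Unitization ℂ A) :=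
      fun t => (isQuasiregular_iff_isUnit' ℂ).1 (h t)
    let F : X → Unitization ℂ A := fun t => 1 + Unitization.inr (f t)
    have hF : Continuous F :=
      continuous_const.add (Unitization.continuous_inr'.comp f.continuous)
    have hG : Continuous fun t => Ring.inverse (F t) := continuous_iff_continuousAt.2 fun t =>
      ContinuousAt.comp (g := Ring.inverse) (f := F)
        (by obtain ⟨u, hu⟩ := hu t; rw [show F t = u from hu.symm]
            exact NormedRing.inverse_continuousAt u) hF.continuousAt
    let y : C(X, A) := ⟨fun t => (Ring.inverse (F t)).snd, Unitization.continuous_snd'.comp hG⟩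
    have key : ∀ t, y t + f t + f t * y t = 0 ∧ f t + y t + y t * f t = 0 := by
      intro t
      have h1 : F t * Ring.inverse (F t) = 1 := Ring.mul_inverse_cancel _ (hu t)
      have h2 : Ring.inverse (F t) * F t = 1 := Ring.inverse_mul_cancel _ (hu t)
      have h3 : (Ring.inverse (F t)).fst = 1 := by
        have := congrArg (fun z : Unitization ℂ A => z.fst) h1
        simpa [F] using this
      have h4 := congrArg (fun z : Unitization ℂ A => z.snd) h1
      have h5 := congrArg (fun z : Unitization ℂ A => z.snd) h2
      simp only [Unitization.snd_mul, h3] at h4 h5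
      simp [F] at h4 h5
      exact ⟨h4, h5⟩
    exact (_root_.isQuasiregular_iff).2 ⟨y, ContinuousMap.ext fun t => (key t).1,
      ContinuousMap.ext fun t => (key t).2⟩

theorem JoinedIn.of_segment_ball {E : Type*} [NormedAddCommGroup E] [NormedSpace ℝ E] {x y : E}
    {δ : ℝ} {U : Set E} (h : Metric.ball x δ ⊆ U) (hy : y ∈ Metric.ball x δ) : JoinedIn U x y :=
  ((convex_ball x δ).isPathConnected ⟨y, hy⟩ |>.joinedIn x
    (Metric.mem_ball_self (Metric.pos_of_mem_ball hy)) y hy).mono h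

/-- Continuous paths in a subalgebra. -/
def pathSubalgebra {A : Type*} [NonUnitalCStarAlgebra A] (B : NonUnitalStarSubalgebra ℂ A) :
    NonUnitalStarSubalgebra ℂ C(unitInterval, A) where
  carrier := {f | ∀ t, f t ∈ B}
  add_mem' hf hg t := add_mem (hf t) (hg t)
  zero_mem' _ := zero_mem B
  mul_mem' hf hg t := mul_mem (hf t) (hg t)
  smul_mem' c _ hf t := SMulMemClass.smul_mem c (hf t)
  star_mem' hf t := star_mem (hf t)

theorem JoinedIn.isUnit_smul {R : Type*} [CStarAlgebra R] {r : R} (hr : IsUnit r) {c : ℂ}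
    (hc : c ≠ 0) : JoinedIn {x : R | IsUnit x} r (c • r) := by
  have hpc : IsPathConnected ({0}ᶜ : Set ℂ) := isPathConnected_compl_singleton_of_one_lt_rank
    (by rw [Complex.rank_real_complex]; exact Cardinal.one_lt_two) 0
  obtain ⟨γ, hγ⟩ := hpc.joinedIn 1 one_ne_zero c hc
  refine ⟨⟨⟨fun t => γ t • r, by fun_prop⟩, by simp, by simp⟩, fun t => ?_⟩
  exact (isUnit_smul_iff (Units.mk0 (γ t) (hγ t)) r).2 hr

theorem JoinedIn.one_isUnit_of_dense {A : Type*} [NonUnitalCStarAlgebra A]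
    (hC : Dense {f : C(unitInterval, A) | IsQuasiregular f}) {B : NonUnitalStarSubalgebra ℂ A}
    [IsClosed (B : Set A)] (hB : IsHereditary B) (r : Unitization ℂ B) (hr : IsUnit r) :
    JoinedIn {x : Unitization ℂ B | IsUnit x} 1 r := by
  have hr0 : r.fst ≠ 0 := (hr.map (Unitization.fstHom ℂ B)).ne_zero
  set b : B := r.fst⁻¹ • r.snd with hb
  have hreq : r = r.fst • (1 + Unitization.inr b) := Unitization.eq_smul_one_add r hr0
  have hbu : IsUnit (1 + Unitization.inr b : Unitization ℂ B) := by
    rw [hreq] at hr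
    exact (isUnit_smul_iff (Units.mk0 _ hr0) _).1 hr
  suffices h : JoinedIn {x : Unitization ℂ B | IsUnit x} 1 (1 + Unitization.inr b) by
    refine h.trans ?_
    rw [hreq]
    exact JoinedIn.isUnit_smul hbu hr0
  obtain ⟨ε₁, hε₁, h₁⟩ := Metric.isOpen_iff.1 (Units.isOpen (R := Unitization ℂ B)) 1 isUnit_one
  obtain ⟨ε₂, hε₂, h₂⟩ := Metric.isOpen_iff.1 (Units.isOpen (R := Unitization ℂ B)) _ hbu
  let f : C(unitInterval, A) := ⟨fun t => (t : ℝ) • (b : A), by fun_prop⟩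
  have hS : IsHereditary (pathSubalgebra B) := fun f hf a g hg t => hB _ (hf t) _ _ (hg t)
  have hfS : f ∈ pathSubalgebra B := fun t => by
    have := SMulMemClass.smul_mem ((t : ℝ) : ℂ) b.2
    rwa [Complex.coe_smul] at this
  obtain ⟨g, hgS, hgf, hgq⟩ := hS.exists_isQuasiregular_near hC hfS (lt_min hε₁ hε₂)
  let G : unitInterval → Unitization ℂ B := fun t => 1 + Unitization.inr ⟨g t, hgS t⟩
  have hG : Continuous G :=
    continuous_const.add (Unitization.continuous_inr'.comp (g.continuous.subtype_mk hgS))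
  have hGu : ∀ t, IsUnit (G t) := fun t => (isQuasiregular_iff_isUnit' ℂ).1
    ((hB.isQuasiregular_iff _).2 ((ContinuousMap.isQuasiregular_iff g).1 hgq t))
  have hd : ∀ t, ‖g t - f t‖ < min ε₁ ε₂ := fun t =>
    ((g - f).norm_coe_le_norm t).trans_lt hgf
  have hG0 : G 0 ∈ Metric.ball (1 : Unitization ℂ B) ε₁ := by
    rw [mem_ball_iff_norm, show G 0 - 1 = Unitization.inr ⟨g 0, hgS 0⟩ by simp [G],
      Unitization.norm_inr]
    simpa [f] using (hd 0).trans_le (min_le_left _ _)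
  have hG1 : G 1 ∈ Metric.ball (1 + Unitization.inr b : Unitization ℂ B) ε₂ := by
    rw [mem_ball_iff_norm, show G 1 - (1 + Unitization.inr b) =
      Unitization.inr (⟨g 1, hgS 1⟩ - b) by simp [G], Unitization.norm_inr]
    simpa [f] using (hd 1).trans_le (min_le_right _ _)
  exact ((JoinedIn.of_segment_ball h₁ hG0).trans
    ⟨⟨⟨G, hG⟩, rfl, rfl⟩, hGu⟩).trans (JoinedIn.of_segment_ball h₂ hG1).symm

theorem Matrix.fromBlocks_mem_unitary {R : Type*} [CStarAlgebra R] {ι κ : Type*} [Fintype ι]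
    [DecidableEq ι] [Fintype κ] [DecidableEq κ] (u : unitary (Matrix ι ι R)) :
    fromBlocks u.1 0 0 (1 : Matrix κ κ R) ∈ unitary (Matrix (ι ⊕ κ) (ι ⊕ κ) R) := by
  have h1 := Unitary.star_mul_self_of_mem u.2
  have h2 := Unitary.mul_star_self_of_mem u.2
  rw [star_eq_conjTranspose] at h1 h2
  rw [Unitary.mem_iff, star_eq_conjTranspose, fromBlocks_conjTranspose, fromBlocks_multiply,
    fromBlocks_multiply]
  simp [h1, h2]

theorem Matrix.joined_unitary_of_joinedIn_isUnit {R : Type*} [CStarAlgebra R] {ι : Type*} [Fintype ι]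
    [DecidableEq ι] (u v : unitary (Matrix ι ι R))
    (h : JoinedIn {M : Matrix ι ι R | IsUnit M} u v) : Joined u v := by
  let : PartialOrder R := CStarAlgebra.spectralOrder R
  have : StarOrderedRing R := CStarAlgebra.spectralOrderedRing R
  exact Unitary.joined_of_joinedIn_isUnit (R := CStarMatrix ι ι R) u v h

theorem k1Trivial_of_dense {A : Type*} [NonUnitalCStarAlgebra A]
    (hA : Dense {a : A | IsQuasiregular a})
    (hC : Dense {f : C(unitInterval, A) | IsQuasiregular f}) {B : NonUnitalStarSubalgebra ℂ A}
    [IsClosed (B : Set A)] (hB : IsHereditary B) : K1Trivial B := by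
  intro n _ u
  have hd : Dense {x : Unitization ℂ B | IsUnit x} :=
    stableRankOne_iff_dense_isQuasiregular.2 (hB.dense_isQuasiregular hA)
  refine ⟨0, fromBlocks_mem_unitary u, joined_unitary_of_joinedIn_isUnit _ _ ?_⟩
  have h := (joinedIn_one_isUnit_fin hd (JoinedIn.one_isUnit_of_dense hC hB) n u.1
    (Unitary.toUnits u).isUnit).reindex_isUnit (Equiv.sumEmpty (Fin n) (Fin 0)).symm
  convert h using 1
  · simp
  · refine Matrix.ext fun a b => ?_
    rcases a with a | a
    · rcases b with b | b
      · simp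
      · exact b.elim0
    · exact a.elim0

theorem K1Trivial.joined_one {B : Type*} [NonUnitalCStarAlgebra B] (hB : K1Trivial B)
    (hd : StableRankOne B) (w : unitary (Unitization ℂ B)) : Joined 1 w := by
  let W : Matrix (Fin 1) (Fin 1) (Unitization ℂ B) := of fun _ _ => w
  have hW : W ∈ unitary (Matrix (Fin 1) (Fin 1) (Unitization ℂ B)) := by
    rw [Unitary.mem_iff]
    constructor
    · refine Matrix.ext fun i j => ?_
      rw [Subsingleton.elim i 0, Subsingleton.elim j 0]
      simp [mul_apply, W, star_apply]
    · refine Matrix.ext fun i j => ?_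
      rw [Subsingleton.elim i 0, Subsingleton.elim j 0]
      simp [mul_apply, W, star_apply]
  obtain ⟨k, hk, ⟨γ⟩⟩ := hB 1 one_pos ⟨W, hW⟩
  have h1 : JoinedIn {N : Matrix (Fin 1 ⊕ Fin k) (Fin 1 ⊕ Fin k) (Unitization ℂ B) | IsUnit N} 1
      (fromBlocks W 0 0 1) :=
    ⟨γ.map continuous_subtype_val, fun t => (Unitary.toUnits (γ t)).isUnit⟩
  obtain ⟨ρ, hρ⟩ := joinedIn_isUnit_of_fromBlocks_fin hd W k h1
  refine Unitary.joined_of_joinedIn_isUnit _ _ ⟨⟨⟨fun t => ρ t 0 0,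
    ρ.continuous.matrix_elem _ _⟩, by simp, by simp [W]⟩, fun t => ?_⟩
  obtain ⟨z, h2, h3⟩ := isUnit_iff_exists.1 (hρ t)
  exact isUnit_iff_exists.2 ⟨z 0 0, by simpa [mul_apply] using congrFun (congrFun h2 0) 0,
    by simpa [mul_apply] using congrFun (congrFun h3 0) 0⟩

end

theorem isUnit_star_mul_self_add {R : Type*} [CStarAlgebra R] {x y : R} (h : IsUnit x ∨ IsUnit y) :
    IsUnit (star x * x + star y * y) := by
  let : PartialOrder R := CStarAlgebra.spectralOrder R
  have : StarOrderedRing R := CStarAlgebra.spectralOrderedRing R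
  rcases h with h | h
  · exact (((h.star.mul h).isStrictlyPositive (star_mul_self_nonneg x)).add_nonneg
      (star_mul_self_nonneg y)).isUnit
  · rw [add_comm]
    exact (((h.star.mul h).isStrictlyPositive (star_mul_self_nonneg y)).add_nonneg
      (star_mul_self_nonneg x)).isUnit

theorem ContinuousMap.isUnit_star_mul_self_add {A : Type*} [NonUnitalCStarAlgebra A]
    {f g : C(unitInterval, A)} (h : ∀ t, IsQuasiregular (f t) ∨ IsQuasiregular (g t)) :
    IsUnit (star (1 + .inr f) * (1 + .inr f) + star (1 + .inr g) * (1 + .inr g) :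
      Unitization ℂ C(unitInterval, A)) := by
  have h2 : (2 : ℂ) ≠ 0 := two_ne_zero
  set M : Unitization ℂ C(unitInterval, A) :=
    star (1 + .inr f) * (1 + .inr f) + star (1 + .inr g) * (1 + .inr g) with hM
  have hfst : M.fst = 2 := by simp [hM]; norm_num
  rw [Unitization.isUnit_iff_isQuasiregular _ (hfst ▸ h2), ContinuousMap.isQuasiregular_iff]
  intro t
  let N : Unitization ℂ A := star (1 + .inr (f t)) * (1 + .inr (f t)) +
    star (1 + .inr (g t)) * (1 + .inr (g t))
  have hN : N.fst = 2 := by simp [N]; norm_num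
  have hu : IsUnit N := _root_.isUnit_star_mul_self_add <| (h t).imp
    (isQuasiregular_iff_isUnit' ℂ).1 (isQuasiregular_iff_isUnit' ℂ).1
  rw [Unitization.isUnit_iff_isQuasiregular _ (hN ▸ h2)] at hu
  convert hu using 1
  rw [hN, hfst]
  simp [hM, N]

theorem dense_isQuasiregular_or {A : Type*} [NonUnitalCStarAlgebra A]
    (hA : Dense {a : A | IsQuasiregular a}) :
    Dense {p : C(unitInterval, A) × C(unitInterval, A) |
      ∀ t, IsQuasiregular (p.1 t) ∨ IsQuasiregular (p.2 t)} := by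
  refine Metric.dense_iff.2 fun ⟨f, g⟩ ε hε => ?_
  have hT : Dense ({a : A | IsQuasiregular a} ×ˢ {a : A | IsQuasiregular a}) := hA.prod hA
  have hloc : ∀ t, ∀ η > 0, ∃ δ > 0, ∀ a ∈ {a : A | IsQuasiregular a} ×ˢ {a : A | IsQuasiregular a},
      ∀ b ∈ {a : A | IsQuasiregular a} ×ˢ {a : A | IsQuasiregular a},
      dist a (f.prodMk g t) < δ → dist b (f.prodMk g t) < δ →
      JoinedIn ({p : A × A | IsQuasiregular p.1 ∨ IsQuasiregular p.2} ∩
        Metric.ball (f.prodMk g t) η) a b := by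
    refine fun t η hη => ⟨η, hη, ?_⟩
    rintro ⟨a, a'⟩ ⟨ha, ha'⟩ ⟨b, b'⟩ ⟨hb, hb'⟩ h1 h2
    rw [Prod.dist_eq, max_lt_iff] at h1 h2
    have hline : ∀ {x y z : A}, dist x z < η → dist y z < η → ∀ s : unitInterval,
        AffineMap.lineMap x y (s : ℝ) ∈ Metric.ball z η := fun hx hy s =>
      (convex_ball _ η).lineMap_mem hx hy s.2
    refine JoinedIn.trans (y := (a, b')) ?_ ?_
    · refine ⟨⟨⟨fun s => (a, AffineMap.lineMap a' b' (s : ℝ)), by fun_prop⟩, by simp, by simp⟩,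
        fun s => ⟨Or.inl ha, ?_⟩⟩
      rw [Metric.mem_ball, Prod.dist_eq]
      exact max_lt h1.1 (hline h1.2 h2.2 s)
    · refine ⟨⟨⟨fun s => (AffineMap.lineMap a b (s : ℝ), b'), by fun_prop⟩, by simp, by simp⟩,
        fun s => ⟨Or.inr hb', ?_⟩⟩
      rw [Metric.mem_ball, Prod.dist_eq]
      exact max_lt (hline h1.1 h2.1 s) h2.2
  obtain ⟨G, hG⟩ := exists_continuousMap_near_of_joinedIn (f.prodMk g) (fun t => hT _) hloc
    (half_pos hε)
  refine ⟨(ContinuousMap.fst.comp G, ContinuousMap.snd.comp G), ?_, fun t => (hG t).1⟩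
  rw [Metric.mem_ball, Prod.dist_eq]
  refine max_lt ?_ ?_
  · refine ((ContinuousMap.dist_le (half_pos hε).le).2 fun t => ?_).trans_lt (half_lt_self hε)
    exact (le_max_left _ _).trans (hG t).2.le
  · refine ((ContinuousMap.dist_le (half_pos hε).le).2 fun t => ?_).trans_lt (half_lt_self hε)
    exact (le_max_right _ _).trans (hG t).2.le

theorem stableRankLE_two {A : Type*} [NonUnitalCStarAlgebra A]
    (hA : Dense {a : A | IsQuasiregular a}) : StableRankLE C(unitInterval, A) 2 := by
  let D : Set (Fin 2 → Unitization ℂ C(unitInterval, A)) := {a | ∀ i, (a i).fst ≠ 0}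
  have hD : Dense D := by
    intro a
    have h0 : (0 : ℂ) ∈ closure (({-(a 0).fst, -(a 1).fst} : Set ℂ)ᶜ) :=
      (Set.Countable.dense_compl ℝ (Set.to_countable _)) 0
    have hc : Continuous fun s : ℂ => fun i =>
        a i + algebraMap ℂ (Unitization ℂ C(unitInterval, A)) s :=
      continuous_pi fun i => continuous_const.add (continuous_algebraMap _ _)
    have := map_mem_closure (t := D) hc h0 fun s hs => by
      simp only [Set.mem_compl_iff, Set.mem_insert_iff, Set.mem_singleton_iff, not_or] at hs
      refine Fin.forall_fin_two.2 ⟨fun h => hs.1 ?_, fun h => hs.2 ?_⟩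
      · exact eq_neg_of_add_eq_zero_right h
      · exact eq_neg_of_add_eq_zero_right h
    simpa using this
  refine dense_closure.1 (hD.mono fun a ha => ?_)
  have hQ := dense_isQuasiregular_or hA ((a 0).fst⁻¹ • (a 0).snd, (a 1).fst⁻¹ • (a 1).snd)
  let Φ : C(unitInterval, A) × C(unitInterval, A) → Fin 2 → Unitization ℂ C(unitInterval, A) :=
    fun p => ![(a 0).fst • (1 + .inr p.1), (a 1).fst • (1 + .inr p.2)]
  have hΦ : Continuous Φ := by
    refine continuous_pi (Fin.forall_fin_two.2 ⟨?_, ?_⟩)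
    · exact (continuous_const_smul (a 0).fst).comp
        (continuous_const.add (Unitization.continuous_inr'.comp continuous_fst))
    · exact (continuous_const_smul (a 1).fst).comp
        (continuous_const.add (Unitization.continuous_inr'.comp continuous_snd))
  have hΦa : Φ ((a 0).fst⁻¹ • (a 0).snd, (a 1).fst⁻¹ • (a 1).snd) = a := by
    refine funext (Fin.forall_fin_two.2 ⟨?_, ?_⟩)
    · exact (Unitization.eq_smul_one_add _ (ha 0)).symm
    · exact (Unitization.eq_smul_one_add _ (ha 1)).symm
  rw [← hΦa]
  refine map_mem_closure hΦ hQ fun ⟨f, g⟩ hp => ?_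
  obtain ⟨z, -, hz⟩ := isUnit_iff_exists.1 (ContinuousMap.isUnit_star_mul_self_add hp)
  refine ⟨![z * ((a 0).fst⁻¹ • star (1 + .inr f)), z * ((a 1).fst⁻¹ • star (1 + .inr g))], ?_⟩
  rw [Fin.sum_univ_two]
  simp only [Φ, Matrix.cons_val_zero, Matrix.cons_val_one, mul_assoc, smul_mul_smul_comm]
  rw [inv_mul_cancel₀ (ha 0), inv_mul_cancel₀ (ha 1), one_smul, one_smul, ← mul_add, hz]

theorem exists_cutoff {R : Type*} [CStarAlgebra R] [PartialOrder R] [StarOrderedRing R] {k : R}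
    (hk : 0 ≤ k) {η : ℝ} (hη : 0 < η) :
    ∃ p χ h : R, star p = p ∧ χ * p = 0 ∧ p * χ = 0 ∧ 1 - χ = k * h ∧ 1 - χ = h * k ∧ ‖χ‖ ≤ 1 ∧
      ‖h‖ ≤ η⁻¹ ∧ ‖k - p‖ ≤ η := by
  have hsa : IsSelfAdjoint k := hk.isSelfAdjoint
  have hpos : ∀ t ∈ spectrum ℝ k, 0 ≤ t := fun t ht => spectrum_nonneg_of_nonneg hk ht
  have hm : ∀ t : ℝ, 0 < max t η := fun t => lt_max_of_lt_right hη
  let fp : ℝ → ℝ := fun t => max 0 (t - η)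
  let fc : ℝ → ℝ := fun t => max 0 (1 - t / η)
  let fh : ℝ → ℝ := fun t => (max t η)⁻¹
  have hfp : Continuous fp := by fun_prop
  have hfc : Continuous fc := by fun_prop
  have hfh : Continuous fh := (continuous_id.max continuous_const).inv₀ fun t => (hm t).ne'
  have hcp : ∀ t, fc t * fp t = 0 := by
    intro t
    rcases le_total t η with h | h
    · simp [fp, h]
    · simp [fc, (one_le_div hη).2 h]
  have hch : ∀ t, 0 ≤ t → 1 - fc t = t * fh t := by
    intro t ht
    rcases le_total t η with h | h
    · have h' : 0 ≤ 1 - t / η := sub_nonneg.2 ((div_le_one hη).2 h)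
      rw [show fc t = 1 - t / η from max_eq_right h', show fh t = η⁻¹ by simp [fh, h]]
      ring
    · have : t ≠ 0 := (hη.trans_le h).ne'
      simp [fc, fh, h, (one_le_div hη).2 h, this]
  have h1 : 1 - cfc fc k = cfc (fun t => 1 - fc t) k := by
    rw [cfc_sub (fun _ => (1 : ℝ)) fc k (by fun_prop) hfc.continuousOn, cfc_const_one ℝ k]
  have h2 : 1 - cfc fc k = cfc (fun t => t * fh t) k := by
    rw [h1]
    exact cfc_congr fun t ht => hch t (hpos t ht)
  refine ⟨cfc fp k, cfc fc k, cfc fh k, (cfc_predicate fp k : IsSelfAdjoint _).star_eq, ?_, ?_, ?_,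
    ?_, ?_, ?_, ?_⟩
  · rw [← cfc_mul fc fp k hfc.continuousOn hfp.continuousOn]
    simp [hcp]
  · rw [← cfc_mul fp fc k hfp.continuousOn hfc.continuousOn]
    simp [hcp, mul_comm (fp _)]
  · rw [h2, cfc_mul (fun t => t) fh k (by fun_prop) hfh.continuousOn, cfc_id' ℝ k]
  · rw [h2, cfc_mul (fun t => t) fh k (by fun_prop) hfh.continuousOn, cfc_id' ℝ k]
    nth_rw 1 [← cfc_id' ℝ k]
    rw [← (cfc_commute_cfc fh _ k).eq, cfc_id' ℝ k]
  · refine norm_cfc_le zero_le_one fun t ht => ?_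
    have := div_nonneg (hpos t ht) hη.le
    rw [Real.norm_of_nonneg (le_max_left _ _)]
    exact max_le zero_le_one (by linarith)
  · refine norm_cfc_le (inv_nonneg.2 hη.le) fun t ht => ?_
    rw [Real.norm_of_nonneg (inv_nonneg.2 (hm t).le)]
    exact inv_anti₀ hη (le_max_right _ _)
  · nth_rw 1 [← cfc_id' ℝ k]
    rw [← cfc_sub (fun t => t) fp k (by fun_prop) hfp.continuousOn]
    refine norm_cfc_le hη.le fun t ht => ?_
    have := hpos t ht
    rw [Real.norm_eq_abs, abs_le]
    rcases le_total t η with h | h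
    · simp [fp, h]; linarith
    · simp [fp, h]; linarith

theorem Unitization.norm_fst_le {A : Type*} [NonUnitalCStarAlgebra A] (x : Unitization ℂ A) :
    ‖x.fst‖ ≤ ‖x‖ :=
  NonUnitalStarAlgHom.norm_apply_le (Unitization.fstHom ℂ A) x

theorem Unitization.eq_one_add_inr {A : Type*} [NonUnitalCStarAlgebra A] {x : Unitization ℂ A}
    (h : x.fst = 1) : x = 1 + .inr x.snd := by
  ext <;> simp [h]

theorem Unitization.fst_abs {A : Type*} [NonUnitalCStarAlgebra A] [PartialOrder (Unitization ℂ A)]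
    [StarOrderedRing (Unitization ℂ A)] {x : Unitization ℂ A} (h : x.fst = 1) :
    (CFC.abs x).fst = 1 := by
  obtain ⟨c, hc⟩ := CStarAlgebra.nonneg_iff_eq_star_mul_self.1 (CFC.abs_nonneg x)
  have h1 := congrArg (fun z : Unitization ℂ A => z.fst) (CFC.abs_mul_abs x)
  simp only [Unitization.fst_mul, Unitization.fst_star, h] at h1
  have h2 : (CFC.abs x).fst = ((‖c.fst‖ ^ 2 : ℝ) : ℂ) := by
    rw [hc]
    simp [Complex.conj_mul']
  rw [h2] at h1 ⊢
  have h3 : ‖c.fst‖ ^ 2 * ‖c.fst‖ ^ 2 = 1 := by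
    have : ((‖c.fst‖ ^ 2 * ‖c.fst‖ ^ 2 : ℝ) : ℂ) = 1 := by
      rw [Complex.ofReal_mul, h1]
      simp
    exact_mod_cast this
  have h4 : ‖c.fst‖ ^ 2 = 1 := by nlinarith [sq_nonneg ‖c.fst‖]
  rw [h4]; simp

theorem Unitization.fst_polarUnitary {A : Type*} [NonUnitalCStarAlgebra A]
    [PartialOrder (Unitization ℂ A)] [StarOrderedRing (Unitization ℂ A)] {x : Unitization ℂ A}
    (hx : IsUnit x) (h : x.fst = 1) : (polarUnitary x).fst = 1 := by
  have := congrArg (fun z : Unitization ℂ A => z.fst) (polarUnitary_mul_abs hx)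
  simpa [Unitization.fst_abs h, h] using this

theorem polar_segment_isUnit {R : Type*} [CStarAlgebra R] [PartialOrder R] [StarOrderedRing R]
    {v h k : R} (hv : v ∈ unitary R) (hh : IsUnit h) (hh0 : 0 ≤ h) (hk : IsUnit k) (hk0 : 0 ≤ k)
    (t : unitInterval) : IsUnit (v * AffineMap.lineMap h k (t : ℝ)) := by
  refine (Unitary.toUnits ⟨v, hv⟩).isUnit.mul ?_
  have h1 := hh.isStrictlyPositive hh0
  have h2 := hk.isStrictlyPositive hk0
  rw [AffineMap.lineMap_apply_module]
  rcases eq_or_ne t 0 with rfl | h0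
  · simpa using hh
  · have : (0 : ℝ) < t := unitInterval.pos_iff_ne_zero.2 h0
    refine IsStrictlyPositive.isUnit ?_
    exact IsStrictlyPositive.nonneg_add (smul_nonneg (by simpa using t.2.2) hh0) (h2.smul this)

theorem Unitization.fst_lineMap {A : Type*} [NonUnitalCStarAlgebra A] {x y : Unitization ℂ A}
    (hx : x.fst = 1) (hy : y.fst = 1) (t : ℝ) : (AffineMap.lineMap x y t).fst = 1 := by
  simp [AffineMap.lineMap_apply_module, hx, hy]

/-- A unit with scalar part `1` and norm at most `2` is joined to `1` through such units. -/
theorem K1Trivial.joinedIn_one {B : Type*} [NonUnitalCStarAlgebra B] (hB : K1Trivial B)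
    (hd : StableRankOne B) {z : Unitization ℂ B} (hz : IsUnit z) (hz1 : z.fst = 1)
    (hz2 : ‖z‖ ≤ 2) :
    JoinedIn {r : Unitization ℂ B | IsUnit r ∧ r.fst = 1 ∧ ‖r‖ ≤ 2} 1 z := by
  let : PartialOrder (Unitization ℂ B) := CStarAlgebra.spectralOrder _
  have : StarOrderedRing (Unitization ℂ B) := CStarAlgebra.spectralOrderedRing _
  have hu := polarUnitary_mem_unitary hz
  have huz := polarUnitary_mul_abs hz
  have hu1 : (polarUnitary z).fst = 1 := Unitization.fst_polarUnitary hz hz1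
  generalize polarUnitary z = u at hu huz hu1
  refine JoinedIn.trans (y := u) ?_ ?_
  · obtain ⟨γ⟩ := hB.joined_one hd ⟨u, hu⟩
    have hγ : ∀ t, star (γ t : Unitization ℂ B).fst * (γ t : Unitization ℂ B).fst = 1 := fun t => by
      have := congrArg (fun x : Unitization ℂ B => x.fst) (Unitary.star_mul_self_of_mem (γ t).2)
      rwa [Unitization.fst_mul, Unitization.fst_star, Unitization.fst_one] at this
    have hn : ∀ t, ‖star (γ t : Unitization ℂ B).fst‖ = 1 := fun t => by
      have := congrArg norm (hγ t)
      rw [norm_mul, norm_star, norm_one] at this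
      rw [norm_star]
      nlinarith [norm_nonneg (γ t : Unitization ℂ B).fst]
    have hc : Continuous fun t => (γ t : Unitization ℂ B) :=
      continuous_subtype_val.comp γ.continuous
    refine ⟨⟨⟨fun t => star (γ t : Unitization ℂ B).fst • (γ t : Unitization ℂ B),
      ((Unitization.continuous_fst'.comp hc).star).smul hc⟩, by simp, by simp [hu1]⟩,
      fun t => ⟨?_, ?_, ?_⟩⟩
    · exact (isUnit_smul_iff (Units.mk0 _ (norm_ne_zero_iff.1 ((hn t).trans_ne one_ne_zero))) _).2
        (Unitary.toUnits (γ t)).isUnit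
    · simpa using hγ t
    · change ‖star (γ t : Unitization ℂ B).fst • (γ t : Unitization ℂ B)‖ ≤ 2
      rw [norm_smul, hn, CStarRing.norm_coe_unitary]
      norm_num
  · have h1 : (1 : Unitization ℂ B).fst = 1 := rfl
    refine ⟨⟨⟨fun t => u * AffineMap.lineMap 1 (CFC.abs z) (t : ℝ), by fun_prop⟩, by simp,
      by simpa using huz⟩, fun t => ⟨?_, ?_, ?_⟩⟩
    · exact polar_segment_isUnit hu isUnit_one zero_le_one (isUnit_cfcAbs hz) (CFC.abs_nonneg z) t
    · simp [hu1, Unitization.fst_lineMap h1 (Unitization.fst_abs hz1)]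
    · have hb : ‖AffineMap.lineMap 1 (CFC.abs z) (t : ℝ)‖ ≤ 2 := by
        have := (convex_closedBall (0 : Unitization ℂ B) 2).lineMap_mem
          (x := 1) (y := CFC.abs z) (by simp) (by simpa [CFC.norm_abs] using hz2) t.2
        simpa using this
      change ‖u * AffineMap.lineMap 1 (CFC.abs z) (t : ℝ)‖ ≤ 2
      rwa [CStarRing.norm_mem_unitary_mul _ hu]

theorem Unitization.fst_sub {A : Type*} [NonUnitalCStarAlgebra A] (x y : Unitization ℂ A) :
    (x - y).fst = x.fst - y.fst := map_sub (Unitization.fstHom ℂ A) x y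

theorem Unitization.sub_one_eq_inr {A : Type*} [NonUnitalCStarAlgebra A] {x : Unitization ℂ A}
    (h : x.fst = 1) : x - 1 = .inr x.snd := by
  nth_rw 1 [Unitization.eq_one_add_inr h]
  exact add_sub_cancel_left _ _

/-- The elements of `A` annihilated on both sides by a self-adjoint element of the unitization. -/
def annihilatorSubalgebra {A : Type*} [NonUnitalCStarAlgebra A] (p : Unitization ℂ A)
    (hp : star p = p) : NonUnitalStarSubalgebra ℂ A where
  carrier := {b | (b : Unitization ℂ A) * p = 0 ∧ p * b = 0}
  add_mem' ha hb := by
    simp only [Set.mem_ofPred_eq] at ha hb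
    simp [add_mul, mul_add, ha, hb]
  zero_mem' := by simp
  mul_mem' {a b} ha hb := by
    simp only [Set.mem_ofPred_eq] at ha hb
    simp only [Set.mem_ofPred_eq, Unitization.inr_mul]
    rw [mul_assoc, hb.1, ← mul_assoc, ha.2]
    simp
  smul_mem' c b hb := by
    simp only [Set.mem_ofPred_eq] at hb
    simp [hb]
  star_mem' {b} hb := by
    simp only [Set.mem_ofPred_eq] at hb
    simp only [Set.mem_ofPred_eq, Unitization.inr_star]
    constructor
    · rw [← hp, ← star_mul, hb.2, star_zero]
    · rw [← hp, ← star_mul, hb.1, star_zero]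

theorem mem_annihilatorSubalgebra {A : Type*} [NonUnitalCStarAlgebra A] {p : Unitization ℂ A}
    {hp : star p = p} {b : A} :
    b ∈ annihilatorSubalgebra p hp ↔ (b : Unitization ℂ A) * p = 0 ∧ p * b = 0 :=
  Iff.rfl

theorem isClosed_annihilatorSubalgebra {A : Type*} [NonUnitalCStarAlgebra A] (p : Unitization ℂ A)
    (hp : star p = p) : IsClosed (annihilatorSubalgebra p hp : Set A) := by
  have h := Unitization.continuous_inr' (A := A)
  exact (isClosed_eq (h.mul continuous_const) continuous_const).inter
    (isClosed_eq (continuous_const.mul h) continuous_const)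

theorem isHereditary_annihilatorSubalgebra {A : Type*} [NonUnitalCStarAlgebra A]
    (p : Unitization ℂ A) (hp : star p = p) : IsHereditary (annihilatorSubalgebra p hp) := by
  intro b hb a b' hb'
  rw [mem_annihilatorSubalgebra] at *
  simp only [Unitization.inr_mul]
  constructor
  · rw [mul_assoc, hb'.1, mul_zero]
  · rw [mul_assoc, ← mul_assoc, hb.2, zero_mul]

theorem joinedIn_one_of_mul_small {A : Type*} [NonUnitalCStarAlgebra A]
    [PartialOrder (Unitization ℂ A)] [StarOrderedRing (Unitization ℂ A)]
    (hA : Dense {a : A | IsQuasiregular a})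
    (hK : ∀ (B : NonUnitalStarSubalgebra ℂ A) [IsClosed (B : Set A)],
      IsHereditary B → K1Trivial B)
    {k w : Unitization ℂ A} (hk : 0 ≤ k) (hk1 : k.fst = 1) {η κ : ℝ} (hη : 0 < η) (hη1 : η < 1)
    (hw : w ∈ unitary (Unitization ℂ A)) (hw1 : w.fst = 1) (h₁ : ‖(w - 1) * k‖ ≤ κ)
    (h₂ : ‖k * (w - 1)‖ ≤ κ) (hκ : 2 * κ < η) :
    JoinedIn {r : Unitization ℂ A | IsUnit r ∧ r.fst = 1 ∧ ‖r‖ ≤ 2 ∧ ‖(r - 1) * k‖ ≤ 3 * η} 1 w := by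
  obtain ⟨p, χ, h, hp, hχp, hpχ, hkh, hhk, hχ, hh, hkp⟩ := exists_cutoff hk hη
  have hp0 : p.fst ≠ 0 := by
    intro h0
    have := (Unitization.norm_fst_le (k - p)).trans hkp
    rw [Unitization.fst_sub, hk1, h0, sub_zero, norm_one] at this
    linarith
  have hχ0 : χ.fst = 0 := by
    have := congrArg (fun z : Unitization ℂ A => z.fst) hχp
    simpa [hp0] using this
  have hinr : ∀ {y : Unitization ℂ A}, y.fst = 0 → ((y.snd : A) : Unitization ℂ A) = y :=
    fun h0 => by ext <;> simp [h0]
  let B := annihilatorSubalgebra p hp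
  have : IsClosed (B : Set A) := isClosed_annihilatorSubalgebra p hp
  have hB : IsHereditary B := isHereditary_annihilatorSubalgebra p hp
  set y : Unitization ℂ A := χ * (w - 1) * χ with hy
  have hy0 : y.fst = 0 := by simp [hy, hχ0]
  have hyB : y.snd ∈ B := by
    refine mem_annihilatorSubalgebra.2 ?_
    rw [hinr hy0, hy]
    constructor
    · rw [mul_assoc, hχp, mul_zero]
    · rw [← mul_assoc, ← mul_assoc, hpχ, zero_mul, zero_mul]
  have hσ : ‖(1 + y) - w‖ < 1 := by
    have e : (1 + y) - w = -((w - 1) * k * h) - h * (k * (w - 1)) * χ := by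
      rw [mul_assoc _ k h, ← hkh, ← mul_assoc h, ← hhk, hy]
      noncomm_ring
    have n1 : ‖(w - 1) * k * h‖ ≤ κ * η⁻¹ :=
      (norm_mul_le _ _).trans (mul_le_mul h₁ hh (norm_nonneg _) ((norm_nonneg _).trans h₁))
    have n2 : ‖h * (k * (w - 1)) * χ‖ ≤ η⁻¹ * κ * 1 :=
      (norm_mul_le _ _).trans (mul_le_mul ((norm_mul_le _ _).trans
        (mul_le_mul hh h₂ (norm_nonneg _) (inv_nonneg.2 hη.le))) hχ (norm_nonneg _)
        (mul_nonneg (inv_nonneg.2 hη.le) ((norm_nonneg _).trans h₁)))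
    have n3 : 2 * κ * η⁻¹ < 1 := by
      rw [← div_eq_mul_inv, div_lt_one hη]
      exact hκ
    rw [e]
    refine (norm_sub_le _ _).trans_lt ?_
    rw [norm_neg]
    linarith
  have hwn : ‖w‖ = 1 := CStarRing.norm_of_mem_unitary hw
  have hyu : IsUnit (1 + y) := isUnit_of_norm_sub_unitary_lt_one hw hσ
  let ι : Unitization ℂ B →⋆ₐ[ℂ] Unitization ℂ A :=
    Unitization.starMap (NonUnitalStarSubalgebraClass.subtype B)
  have hι : ∀ r : Unitization ℂ B, ‖ι r‖ = ‖r‖ := fun r =>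
    NonUnitalStarAlgHom.norm_map ι (Unitization.starMap_injective Subtype.val_injective) r
  have hι1 : ∀ r : Unitization ℂ B, (ι r).fst = r.fst := fun r => by
    simp [ι, Unitization.algebraMap_eq_inl]
  have hι2 : ∀ r : Unitization ℂ B, (ι r).snd = r.snd := fun r => by
    simp [ι, Unitization.algebraMap_eq_inl]
  let z : Unitization ℂ B := 1 + .inr ⟨y.snd, hyB⟩
  have hιz : ι z = 1 + y := by
    ext
    · simp [hι1, z, hy0]
    · simp [hι2, z]
  have hz : IsUnit z := by
    refine (isQuasiregular_iff_isUnit' ℂ).1 ((hB.isQuasiregular_iff _).2 ?_)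
    refine (isQuasiregular_iff_isUnit' ℂ).2 ?_
    rwa [hinr hy0]
  have hzn : ‖z‖ ≤ 2 := by
    rw [← hι, hιz]
    linarith [norm_sub_norm_le (1 + y) w]
  have hkB : ∀ r : Unitization ℂ B, r.fst = 1 → ‖r‖ ≤ 2 → ‖(ι r - 1) * k‖ ≤ 3 * η := by
    intro r hr1 hr2
    have e : (ι r - 1) * k = (ι r - 1) * (k - p) := by
      have : ι r - 1 = .inr (r.snd : A) := by
        rw [Unitization.sub_one_eq_inr ((hι1 r).trans hr1), hι2]
      rw [mul_sub, this, (mem_annihilatorSubalgebra.1 r.snd.2).1, sub_zero]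
    rw [e]
    refine (norm_mul_le _ _).trans (mul_le_mul ?_ hkp (norm_nonneg _) (by norm_num))
    refine (norm_sub_le _ _).trans ?_
    rw [norm_one]
    linarith [hι r]
  obtain ⟨γ, hγ⟩ := (hK B hB).joinedIn_one
    (stableRankOne_iff_dense_isQuasiregular.2 (hB.dense_isQuasiregular hA)) hz (by simp [z]) hzn
  refine JoinedIn.trans (y := 1 + y) ?_ ?_
  · refine ⟨⟨⟨fun t => ι (γ t), (map_continuous ι).comp γ.continuous⟩, by simp, by simp [hιz]⟩,
      fun t => ⟨(hγ t).1.map ι, (hι1 _).trans (hγ t).2.1, (hι _).trans_le (hγ t).2.2, ?_⟩⟩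
    exact hkB _ (hγ t).2.1 (hγ t).2.2
  · have hc : ∀ t : unitInterval, AffineMap.lineMap (1 + y) w (t : ℝ) ∈ Metric.ball w 1 :=
      fun t => (convex_ball w 1).lineMap_mem (mem_ball_iff_norm.2 hσ) (Metric.mem_ball_self one_pos)
        t.2
    refine ⟨⟨⟨fun t => AffineMap.lineMap (1 + y) w (t : ℝ), by fun_prop⟩, by simp, by simp⟩,
      fun t => ⟨?_, ?_, ?_, ?_⟩⟩
    · exact isUnit_of_norm_sub_unitary_lt_one hw (mem_ball_iff_norm.1 (hc t))
    · exact Unitization.fst_lineMap (by simp [hy0]) hw1 t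
    · change ‖AffineMap.lineMap (1 + y) w (t : ℝ)‖ ≤ 2
      have := norm_sub_norm_le (AffineMap.lineMap (1 + y) w (t : ℝ)) w
      linarith [mem_ball_iff_norm.1 (hc t)]
    · have hconv : Convex ℝ {r : Unitization ℂ A | ‖(r - 1) * k‖ ≤ 3 * η} := by
        intro a ha b hb s t hs ht hst
        have e : (s • a + t • b - 1) * k = s • ((a - 1) * k) + t • ((b - 1) * k) := by
          rw [← smul_mul_assoc, ← smul_mul_assoc, ← add_mul, smul_sub, smul_sub,
            sub_add_sub_comm, ← add_smul, hst, one_smul]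
        have := (convex_closedBall (0 : Unitization ℂ A) (3 * η)) (by simpa using ha)
          (by simpa using hb) hs ht hst
        rw [← e] at this
        simpa using this
      refine hconv.lineMap_mem ?_ ?_ t.2
      · rw [← hιz]
        exact hkB z (by simp [z]) hzn
      · exact h₁.trans (by linarith)

/-- Units with scalar part `1` close to a point are joined by small paths of such units. -/
theorem exists_joinedIn_isUnit_ball {A : Type*} [NonUnitalCStarAlgebra A]
    (hA : Dense {a : A | IsQuasiregular a})
    (hK : ∀ (B : NonUnitalStarSubalgebra ℂ A) [IsClosed (B : Set A)],
      IsHereditary B → K1Trivial B)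
    {x : Unitization ℂ A} (hx : x.fst = 1) {ε : ℝ} (hε : 0 < ε) :
    ∃ δ > 0, ∀ a ∈ {r : Unitization ℂ A | IsUnit r ∧ r.fst = 1},
      ∀ b ∈ {r : Unitization ℂ A | IsUnit r ∧ r.fst = 1}, dist a x < δ → dist b x < δ →
        JoinedIn ({r : Unitization ℂ A | IsUnit r ∧ r.fst = 1} ∩ Metric.ball x ε) a b := by
  let : PartialOrder (Unitization ℂ A) := CStarAlgebra.spectralOrder _
  have : StarOrderedRing (Unitization ℂ A) := CStarAlgebra.spectralOrderedRing _
  set k := CFC.abs x with hk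
  have hks : star k = k := (CFC.abs_nonneg x).isSelfAdjoint.star_eq
  obtain ⟨η, hη, hη1, hηε⟩ : ∃ η : ℝ, 0 < η ∧ η < 1 ∧ 6 * η ≤ ε :=
    ⟨min (1 / 2) (ε / 6), by positivity, (min_le_left _ _).trans_lt (by norm_num),
      by linarith [min_le_right (1 / 2) (ε / 6)]⟩
  set τ := η / 16 with hτ
  have hτ0 : 0 < τ := by positivity
  obtain ⟨δ, hδ, hδτ⟩ := Metric.continuous_iff.1 (CFC.continuous_abs (A := Unitization ℂ A)) x τ hτ0
  refine ⟨min δ τ, lt_min hδ hτ0, fun a ⟨ha, ha1⟩ b ⟨hb, hb1⟩ hax hbx => ?_⟩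
  have hak : ‖CFC.abs a - k‖ < τ := by
    simpa [dist_eq_norm] using hδτ a (hax.trans_le (min_le_left _ _))
  have hbk : ‖CFC.abs b - k‖ < τ := by
    simpa [dist_eq_norm] using hδτ b (hbx.trans_le (min_le_left _ _))
  have hax' : ‖a - x‖ < τ := by simpa [dist_eq_norm] using hax.trans_le (min_le_right _ _)
  have hbx' : ‖b - x‖ < τ := by simpa [dist_eq_norm] using hbx.trans_le (min_le_right _ _)
  have hu := polarUnitary_mem_unitary ha
  have hv := polarUnitary_mem_unitary hb
  have hua := polarUnitary_mul_abs ha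
  have hvb := polarUnitary_mul_abs hb
  have hu1 := Unitization.fst_polarUnitary ha ha1
  have hv1 := Unitization.fst_polarUnitary hb hb1
  have hc1 := Unitization.fst_abs ha1
  have hd1 := Unitization.fst_abs hb1
  have hc := isUnit_cfcAbs ha
  have hd := isUnit_cfcAbs hb
  have hc0 := CFC.abs_nonneg a
  have hd0 := CFC.abs_nonneg b
  generalize polarUnitary a = u at *
  generalize polarUnitary b = v at *
  generalize CFC.abs a = c at *
  generalize CFC.abs b = d at *
  have huk : ‖u * k - x‖ ≤ 2 * τ := by
    have e : u * k - x = (a - x) - u * (c - k) := by rw [mul_sub, hua]; abel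
    rw [e]
    refine (norm_sub_le _ _).trans ?_
    rw [CStarRing.norm_mem_unitary_mul _ hu]
    linarith
  have hvk : ‖v * k - x‖ ≤ 2 * τ := by
    have e : v * k - x = (b - x) - v * (d - k) := by rw [mul_sub, hvb]; abel
    rw [e]
    refine (norm_sub_le _ _).trans ?_
    rw [CStarRing.norm_mem_unitary_mul _ hv]
    linarith
  have huv : ‖v * k - u * k‖ ≤ 4 * τ := by
    rw [← sub_sub_sub_cancel_right _ _ x]
    exact (norm_sub_le _ _).trans (by linarith)
  set w := star u * v with hw
  have hwu : w ∈ unitary (Unitization ℂ A) := mul_mem (Unitary.star_mem hu) hv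
  have huw : u * w = v := by rw [hw, ← mul_assoc, Unitary.mul_star_self_of_mem hu, one_mul]
  have hvw : v * star w = u := by
    rw [hw, star_mul, star_star, ← mul_assoc, Unitary.mul_star_self_of_mem hv, one_mul]
  have h₁ : ‖(w - 1) * k‖ ≤ 4 * τ := by
    rw [← CStarRing.norm_mem_unitary_mul _ hu, ← mul_assoc, mul_sub, huw, mul_one, sub_mul]
    exact huv
  have h₂ : ‖k * (w - 1)‖ ≤ 4 * τ := by
    rw [← norm_star, star_mul, star_sub, star_one, hks,
      ← CStarRing.norm_mem_unitary_mul _ hv, ← mul_assoc, mul_sub, hvw, mul_one, sub_mul,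
      norm_sub_rev]
    exact huv
  obtain ⟨γ, hγ⟩ := joinedIn_one_of_mul_small hA hK (CFC.abs_nonneg x) (Unitization.fst_abs hx)
    hη hη1 hwu (by simp [hw, hu1, hv1]) h₁ h₂ (by linarith)
  refine JoinedIn.trans (y := v * c) ?_ ?_
  · refine ⟨⟨⟨fun t => u * γ t * c, by fun_prop⟩, by simp [hua], by simp [huw]⟩,
      fun t => ⟨⟨?_, ?_⟩, ?_⟩⟩
    · exact ((Unitary.toUnits ⟨u, hu⟩).isUnit.mul (hγ t).1).mul hc
    · simp [hu1, hc1, (hγ t).2.1]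
    · rw [mem_ball_iff_norm]
      change ‖u * γ t * c - x‖ < ε
      have e : u * γ t * c - x = u * (γ t * (c - k)) + u * ((γ t - 1) * k) + (u * k - x) := by
        noncomm_ring
      have n1 : ‖γ t * (c - k)‖ ≤ 2 * τ :=
        (norm_mul_le _ _).trans (mul_le_mul (hγ t).2.2.1 hak.le (norm_nonneg _) zero_le_two)
      rw [e]
      refine (norm_add₃_le).trans_lt ?_
      rw [CStarRing.norm_mem_unitary_mul _ hu, CStarRing.norm_mem_unitary_mul _ hu]
      linarith [(hγ t).2.2.2]
  · refine ⟨⟨⟨fun t => v * AffineMap.lineMap c d (t : ℝ), by fun_prop⟩, by simp,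
      by simpa using hvb⟩, fun t => ⟨⟨polar_segment_isUnit hv hc hc0 hd hd0 t, ?_⟩, ?_⟩⟩
    · simp [hv1, Unitization.fst_lineMap hc1 hd1]
    · rw [mem_ball_iff_norm]
      change ‖v * AffineMap.lineMap c d (t : ℝ) - x‖ < ε
      have n1 := mem_ball_iff_norm.1 ((convex_ball k τ).lineMap_mem (mem_ball_iff_norm.2 hak)
        (mem_ball_iff_norm.2 hbk) t.2)
      have e : v * AffineMap.lineMap c d (t : ℝ) - x =
          v * (AffineMap.lineMap c d (t : ℝ) - k) + (v * k - x) := by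
        noncomm_ring
      rw [e]
      refine (norm_add_le _ _).trans_lt ?_
      rw [CStarRing.norm_mem_unitary_mul _ hv]
      linarith

theorem dense_isQuasiregular_continuousMap {A : Type*} [NonUnitalCStarAlgebra A]
    (hA : Dense {a : A | IsQuasiregular a})
    (hK : ∀ (B : NonUnitalStarSubalgebra ℂ A) [IsClosed (B : Set A)],
      IsHereditary B → K1Trivial B) :
    Dense {f : C(unitInterval, A) | IsQuasiregular f} := by
  refine Metric.dense_iff.2 fun f ε hε => ?_
  have hadd : Continuous fun a : A => (1 + .inr a : Unitization ℂ A) := by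
    have := Unitization.continuous_inr' (A := A)
    fun_prop
  let F : C(unitInterval, Unitization ℂ A) :=
    ⟨fun t => 1 + .inr (f t), hadd.comp f.continuous⟩
  have hT : ∀ t, F t ∈ closure {r : Unitization ℂ A | IsUnit r ∧ r.fst = 1} := fun t =>
    map_mem_closure (f := fun a : A => (1 + .inr a : Unitization ℂ A))
      hadd (hA (f t))
      fun a ha => ⟨(isQuasiregular_iff_isUnit' ℂ).1 ha, by simp⟩
  obtain ⟨G, hG⟩ := exists_continuousMap_near_of_joinedIn F hT
    (fun t η hη => exists_joinedIn_isUnit_ball hA hK (by simp [F]) hη) (half_pos hε)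
  refine ⟨⟨fun t => (G t).snd, Unitization.continuous_snd'.comp G.continuous⟩, ?_, ?_⟩
  · rw [Metric.mem_ball]
    refine ((ContinuousMap.dist_le (half_pos hε).le).2 fun t => ?_).trans_lt (half_lt_self hε)
    have h := (hG t).2
    rw [dist_eq_norm, Unitization.eq_one_add_inr (hG t).1.2] at h
    have e : 1 + .inr (G t).snd - F t = (.inr ((G t).snd - f t) : Unitization ℂ A) := by simp [F]
    rw [e, Unitization.norm_inr] at h
    exact (dist_eq_norm _ _).trans_le h.le
  · refine (ContinuousMap.isQuasiregular_iff _).2 fun t => (isQuasiregular_iff_isUnit' ℂ).2 ?_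
    have := (hG t).1.1
    rwa [Unitization.eq_one_add_inr (hG t).1.2] at this

theorem stableRank_spec {A : Type*} [NonUnitalCStarAlgebra A] {n : ℕ} (hn : 0 < n)
    (h : StableRankLE A n) : 0 < stableRank A ∧ StableRankLE A (stableRank A) :=
  Nat.sInf_mem (s := {n : ℕ | 0 < n ∧ StableRankLE A n}) ⟨n, hn, h⟩

theorem stableRank_le {A : Type*} [NonUnitalCStarAlgebra A] {n : ℕ} (hn : 0 < n)
    (h : StableRankLE A n) : stableRank A ≤ n :=
  Nat.sInf_le ⟨hn, h⟩

theorem stableRank_eq_one_iff {A : Type*} [NonUnitalCStarAlgebra A] {n : ℕ} (hn : 0 < n)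
    (h : StableRankLE A n) : stableRank A = 1 ↔ Dense {a : A | IsQuasiregular a} := by
  rw [← stableRankOne_iff_dense_isQuasiregular, ← stableRankLE_one_iff]
  exact ⟨fun h1 => h1 ▸ (stableRank_spec hn h).2,
    fun h1 => le_antisymm (stableRank_le one_pos h1) (stableRank_spec hn h).1⟩

end

theorem stmt2 (A : Type*) [NonUnitalCStarAlgebra A] (hA : StableRankOne A) :
    (NoK1Obstructions A → stableRank C(unitInterval, A) = 1) ∧
    (¬ NoK1Obstructions A → stableRank C(unitInterval, A) = 2) := by
  have hA' := stableRankOne_iff_dense_isQuasiregular.1 hA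
  have h2 := stableRankLE_two hA'
  have h1 := stableRank_eq_one_iff two_pos h2
  refine ⟨fun h => h1.2 (dense_isQuasiregular_continuousMap hA' h.2), fun h => ?_⟩
  have hne : stableRank C(unitInterval, A) ≠ 1 := fun h' =>
    h ⟨hA, fun B _ hB => k1Trivial_of_dense hA' (h1.1 h') hB⟩
  have := stableRank_le two_pos h2
  have := (stableRank_spec two_pos h2).1
  omega
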